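/- Fix an integer n ≥ 1 and let Y_n be the R-submodule of C_n ⊗_R C_n spanned by: y_i⊗y_i for odd i with −2n+1 ≤ i ≤ 2n−1; y_i⊗y_{i+2} for odd i with −2n+1 ≤ i ≤ −3; y_{i+2}⊗y_i for odd i with −1 ≤ i ≤ 2n−3; y_i⊗x_{i+1} for odd i with −2n+1 ≤ i ≤ −3; x_i⊗y_{i+1} for even i with −2n+2 ≤ i ≤ −2; x_i⊗y_{i−1} for even i with 0 ≤ i ≤ 2n−2; y_i⊗x_{i−1} for odd i with 1 ≤ i ≤ 2n−1; together with the four elements y₁⊗y₋₁ + y₋₁⊗y₁, y₋₁⊗x₀ + x₀⊗y₋₁, y₁⊗x₀ + x₀⊗y₁, and x₀⊗x₀. Then: (i) Y_n is a subcomplex of C_n⊗_R C_n and is preserved by τ⊗τ; (ii) there is a bigraded isomorphism of chain complexes from E_n onto Y_n carrying τ_E to the restriction of τ⊗τ; (iii) the inclusion Y_n ↪ C_n⊗_R C_n induces an isomorphism on homology after tensoring over R with F₂[U^{±1}, V^{±1}]. -/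

import Mathlib

open Finsupp

/-- The field with two elements. -/
abbrev F2 : Type := ZMod 2

/-- The ring `R = F₂[U,V]`: `U = X 0`, `V = X 1`. -/
abbrev R2 : Type := MvPolynomial (Fin 2) F2

noncomputable def UU : R2 := MvPolynomial.X 0
noncomputable def VV : R2 := MvPolynomial.X 1

/-- The involution of `R = F₂[U,V]` exchanging `U` and `V`. -/
noncomputable def swUV : R2 →+* R2 :=
  (MvPolynomial.rename (Equiv.swap (0 : Fin 2) 1)).toRingHom

/-- The skew-equivariant (semilinear over `swUV`) extension of a map given on basis
elements. -/
noncomputable def skewExt {β γ : Type} (f : β → (γ →₀ R2)) :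
    (β →₀ R2) → (γ →₀ R2) :=
  fun ξ => Finsupp.linearCombination R2 f (ξ.mapRange (swUV ·) (map_zero _))

/-- The element `f ⊗ g` in the concrete realization `β × γ →₀ R` of the tensor product
`(β →₀ R) ⊗_R (γ →₀ R)` of free `R`-modules. -/
noncomputable def tp {β γ : Type} (f : β →₀ R2) (g : γ →₀ R2) : (β × γ) →₀ R2 :=
  f.sum fun a c => g.sum fun b c' => Finsupp.single (a, b) (c * c')

/-- Homogeneity of bidegree `deg` in a free bigraded `R`-module with basis bigrading
`g` (recall `U` has bidegree `(−2,0)` and `V` has bidegree `(0,−2)`). -/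
def Homog {β : Type} (g : β → ℤ × ℤ) (deg : ℤ × ℤ) (ξ : β →₀ R2) : Prop :=
  ∀ b ∈ ξ.support, ∀ m ∈ (ξ b).support,
    (g b).1 - 2 * (m 0 : ℤ) = deg.1 ∧ (g b).2 - 2 * (m 1 : ℤ) = deg.2

/-! ### The staircase complex `C_n` and its reflection involution `τ` -/

abbrev XIdx (n : ℤ) := {k : ℤ // k % 2 = 0 ∧ -(2*n - 2) ≤ k ∧ k ≤ 2*n - 2}
abbrev YIdx (n : ℤ) := {l : ℤ // l % 2 = 1 ∧ -(2*n - 1) ≤ l ∧ l ≤ 2*n - 1}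
abbrev CB (n : ℤ) := XIdx n ⊕ YIdx n
abbrev Cc (n : ℤ) := CB n →₀ R2

/-- The generator `x_k` of `C_n` (`0` for out-of-range `k`). -/
noncomputable def xC (n k : ℤ) : Cc n :=
  if h : k % 2 = 0 ∧ -(2*n - 2) ≤ k ∧ k ≤ 2*n - 2 then single (.inl ⟨k, h⟩) 1 else 0

/-- The generator `y_ℓ` of `C_n` (`0` for out-of-range `ℓ`). -/
noncomputable def yC (n l : ℤ) : Cc n :=
  if h : l % 2 = 1 ∧ -(2*n - 1) ≤ l ∧ l ≤ 2*n - 1 then single (.inr ⟨l, h⟩) 1 else 0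

/-- The differential of `C_n`: `∂x_k = V^{(k+2n)/2} y_{k−1} + U^{(2n−k)/2} y_{k+1}`,
`∂y_ℓ = 0`. -/
noncomputable def dC (n : ℤ) : Cc n →ₗ[R2] Cc n :=
  linearCombination R2 fun b => match b with
  | .inl ⟨k, _⟩ =>
      VV ^ (((k + 2*n)/2).toNat) • yC n (k - 1) + UU ^ (((2*n - k)/2).toNat) • yC n (k + 1)
  | .inr _ => 0

/-- Values of the reflection involution `τ` of `C_n` on basis elements:
`τ(x_k) = x_{−k}`, `τ(y_ℓ) = y_{−ℓ}`. -/
noncomputable def τCb (n : ℤ) : CB n → Cc n := fun b => match b with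
  | .inl ⟨k, _⟩ => xC n (-k)
  | .inr ⟨l, _⟩ => yC n (-l)

/-! ### The tensor product `C_n ⊗_R C_n` -/

abbrev Tc (n : ℤ) := (CB n × CB n) →₀ R2

/-- The differential `∂ ⊗ id + id ⊗ ∂` of `C_n ⊗_R C_n`. -/
noncomputable def dT (n : ℤ) : Tc n →ₗ[R2] Tc n :=
  linearCombination R2 fun p =>
    tp (dC n (single p.1 1)) (single p.2 1) + tp (single p.1 1) (dC n (single p.2 1))

/-- The skew-equivariant map `τ ⊗ τ` on `C_n ⊗_R C_n`. -/
noncomputable def ττ (n : ℤ) : Tc n → Tc n :=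
  skewExt fun p => tp (τCb n p.1) (τCb n p.2)

/-! ### The complex `E_n = D_n ⊕ S_n` and the map `τ_E` -/

abbrev WIdx (n : ℤ) := {k : ℤ // k % 2 = 1 ∧ -(4*n - 3) ≤ k ∧ k ≤ 4*n - 3}
abbrev ZIdx (n : ℤ) := {l : ℤ // l % 2 = 0 ∧ -(4*n - 2) ≤ l ∧ l ≤ 4*n - 2}

/-- Basis of the square complex `S_n`: `r₀, r₋₁, r₁, t`. -/
inductive SB : Type | r0 : SB | rm : SB | rp : SB | t : SB

abbrev EB (n : ℤ) := (WIdx n ⊕ ZIdx n) ⊕ SB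
abbrev Ec (n : ℤ) := EB n →₀ R2

noncomputable def wE (n k : ℤ) : Ec n :=
  if h : k % 2 = 1 ∧ -(4*n - 3) ≤ k ∧ k ≤ 4*n - 3 then single (.inl (.inl ⟨k, h⟩)) 1 else 0
noncomputable def zE (n l : ℤ) : Ec n :=
  if h : l % 2 = 0 ∧ -(4*n - 2) ≤ l ∧ l ≤ 4*n - 2 then single (.inl (.inr ⟨l, h⟩)) 1 else 0
noncomputable def sE (n : ℤ) (s : SB) : Ec n := single (.inr s) 1

/-- The differential of `E_n = D_n ⊕ S_n`:
`∂w_k = V^{⌈(k+4n−1)/4⌉} z_{k−1} + U^{⌈(4n−1−k)/4⌉} z_{k+1}` (and `⌈m/4⌉ = ⌊(m+3)/4⌋`),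
`∂z_ℓ = 0`, `∂r₀ = Vⁿ r₋₁ + Uⁿ r₁`, `∂r₋₁ = Uⁿ t`, `∂r₁ = Vⁿ t`, `∂t = 0`. -/
noncomputable def dE (n : ℤ) : Ec n →ₗ[R2] Ec n :=
  linearCombination R2 fun b => match b with
  | .inl (.inl ⟨k, _⟩) =>
      VV ^ (((k + 4*n + 2)/4).toNat) • zE n (k - 1) +
        UU ^ (((4*n + 2 - k)/4).toNat) • zE n (k + 1)
  | .inl (.inr _) => 0
  | .inr SB.r0 => VV ^ n.toNat • sE n SB.rm + UU ^ n.toNat • sE n SB.rp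
  | .inr SB.rm => UU ^ n.toNat • sE n SB.t
  | .inr SB.rp => VV ^ n.toNat • sE n SB.t
  | .inr SB.t => 0

/-- The skew-equivariant map `τ_E` of `E_n`: `τ_E(w_k) = w_{−k}` for `k ≠ ±1`,
`τ_E(w₋₁) = w₁ + r₁`, `τ_E(w₁) = w₋₁ + r₋₁`, `τ_E(z_ℓ) = z_{−ℓ}` for `ℓ ≠ 0`,
`τ_E(z₀) = z₀ + t`, `τ_E(r₀) = r₀`, `τ_E(r₋₁) = r₁`, `τ_E(r₁) = r₋₁`, `τ_E(t) = t`. -/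
noncomputable def τE (n : ℤ) : Ec n → Ec n :=
  skewExt fun b => match b with
  | .inl (.inl ⟨k, _⟩) =>
      if k = -1 then wE n 1 + sE n SB.rp
      else if k = 1 then wE n (-1) + sE n SB.rm
      else wE n (-k)
  | .inl (.inr ⟨l, _⟩) => if l = 0 then zE n 0 + sE n SB.t else zE n (-l)
  | .inr SB.r0 => sE n SB.r0
  | .inr SB.rm => sE n SB.rp
  | .inr SB.rp => sE n SB.rm
  | .inr SB.t => sE n SB.t

/-! ### Bigradings -/

/-- Defining conditions on the bigrading of `C_n` (differential of bidegree `(−1,−1)`,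
normalization `gr_V(y_{−2n+1}) = gr_U(y_{2n−1}) = 0`). -/
def IsCGrading (n : ℤ) (gx gy : ℤ → ℤ × ℤ) : Prop :=
  (gy (-(2*n) + 1)).2 = 0 ∧ (gy (2*n - 1)).1 = 0 ∧
  ∀ k : ℤ, k % 2 = 0 → -(2*n - 2) ≤ k → k ≤ 2*n - 2 →
    gy (k - 1) = ((gx k).1 - 1, (gx k).2 - 1 + (k + 2*n)) ∧
    gy (k + 1) = ((gx k).1 - 1 + (2*n - k), (gx k).2 - 1)

/-- Defining conditions on the bigrading of `D_n` (differential of bidegree `(−1,−1)`,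
normalization `gr_V(z_{−4n+2}) = gr_U(z_{4n−2}) = 0`). -/
def IsDGrading (n : ℤ) (gw gz : ℤ → ℤ × ℤ) : Prop :=
  (gz (-(4*n) + 2)).2 = 0 ∧ (gz (4*n - 2)).1 = 0 ∧
  ∀ k : ℤ, k % 2 = 1 → -(4*n - 3) ≤ k → k ≤ 4*n - 3 →
    gz (k - 1) = ((gw k).1 - 1, (gw k).2 - 1 + 2*((k + 4*n + 2)/4)) ∧
    gz (k + 1) = ((gw k).1 - 1 + 2*((4*n + 2 - k)/4), (gw k).2 - 1)

/-- Defining conditions on the bigrading of `S_n` (differential of bidegree `(−1,−1)`,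
normalization `gr(t) = gr(z₀)`). -/
def IsSGrading (n : ℤ) (gz : ℤ → ℤ × ℤ) (gS : SB → ℤ × ℤ) : Prop :=
  gS SB.t = gz 0 ∧
  (gS SB.rm).1 - 1 = (gS SB.t).1 - 2*n ∧ (gS SB.rm).2 - 1 = (gS SB.t).2 ∧
  (gS SB.rp).1 - 1 = (gS SB.t).1 ∧ (gS SB.rp).2 - 1 = (gS SB.t).2 - 2*n ∧
  (gS SB.r0).1 - 1 = (gS SB.rm).1 ∧ (gS SB.r0).2 - 1 = (gS SB.rm).2 - 2*n ∧
  (gS SB.r0).1 - 1 = (gS SB.rp).1 - 2*n ∧ (gS SB.r0).2 - 1 = (gS SB.rp).2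

/-- The bigrading of the basis of `C_n`. -/
def grC (gx gy : ℤ → ℤ × ℤ) {n : ℤ} : CB n → ℤ × ℤ := fun b => match b with
  | .inl ⟨k, _⟩ => gx k
  | .inr ⟨l, _⟩ => gy l

/-- The bigrading of the basis of `C_n ⊗_R C_n`. -/
def grT (gx gy : ℤ → ℤ × ℤ) {n : ℤ} : CB n × CB n → ℤ × ℤ := fun p =>
  grC gx gy p.1 + grC gx gy p.2

/-- The bigrading of the basis of `E_n = D_n ⊕ S_n`. -/
def grE (gw gz : ℤ → ℤ × ℤ) (gS : SB → ℤ × ℤ) {n : ℤ} : EB n → ℤ × ℤ := fun b =>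
  match b with
  | .inl (.inl ⟨k, _⟩) => gw k
  | .inl (.inr ⟨l, _⟩) => gz l
  | .inr s => gS s

/-! ### The subcomplex `Y_n ⊆ C_n ⊗_R C_n` -/

/-- The generators of the `R`-submodule `Y_n` of `C_n ⊗_R C_n`. -/
noncomputable def YGens (n : ℤ) : Set (Tc n) :=
  {ξ | (∃ i : ℤ, i % 2 = 1 ∧ -(2*n - 1) ≤ i ∧ i ≤ 2*n - 1 ∧ ξ = tp (yC n i) (yC n i)) ∨
       (∃ i : ℤ, i % 2 = 1 ∧ -(2*n - 1) ≤ i ∧ i ≤ -3 ∧ ξ = tp (yC n i) (yC n (i + 2))) ∨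
       (∃ i : ℤ, i % 2 = 1 ∧ -1 ≤ i ∧ i ≤ 2*n - 3 ∧ ξ = tp (yC n (i + 2)) (yC n i)) ∨
       (∃ i : ℤ, i % 2 = 1 ∧ -(2*n - 1) ≤ i ∧ i ≤ -3 ∧ ξ = tp (yC n i) (xC n (i + 1))) ∨
       (∃ i : ℤ, i % 2 = 0 ∧ -(2*n - 2) ≤ i ∧ i ≤ -2 ∧ ξ = tp (xC n i) (yC n (i + 1))) ∨
       (∃ i : ℤ, i % 2 = 0 ∧ 0 ≤ i ∧ i ≤ 2*n - 2 ∧ ξ = tp (xC n i) (yC n (i - 1))) ∨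
       (∃ i : ℤ, i % 2 = 1 ∧ 1 ≤ i ∧ i ≤ 2*n - 1 ∧ ξ = tp (yC n i) (xC n (i - 1))) ∨
       ξ = tp (yC n 1) (yC n (-1)) + tp (yC n (-1)) (yC n 1) ∨
       ξ = tp (yC n (-1)) (xC n 0) + tp (xC n 0) (yC n (-1)) ∨
       ξ = tp (yC n 1) (xC n 0) + tp (xC n 0) (yC n 1) ∨
       ξ = tp (xC n 0) (xC n 0)}

/-- The `R`-submodule `Y_n` of `C_n ⊗_R C_n`. -/
noncomputable def Ysub (n : ℤ) : Submodule R2 (Tc n) := Submodule.span R2 (YGens n)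


/-! ### Elementary facts about `F₂[U,V]` -/

lemma UU_ne_zero : UU ≠ 0 := MvPolynomial.X_ne_zero 0

lemma VV_ne_zero : VV ≠ 0 := MvPolynomial.X_ne_zero 1

lemma add_self_of_R2_module {M : Type*} [AddCommGroup M] [Module R2 M] (x : M) : x + x = 0 := by
  have h : (2 : R2) = 0 := CharTwo.two_eq_zero
  rw [← two_smul R2 x, h, zero_smul]

lemma neg_eq_self_of_R2_module {M : Type*} [AddCommGroup M] [Module R2 M] (x : M) : -x = x :=
  neg_eq_of_add_eq_zero_left (add_self_of_R2_module x)

/-! ### The product `tp` and skew-equivariant extensions -/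

section Tensor

variable {β γ : Type}

lemma tp_single_single (a : β) (b : γ) (r s : R2) :
    tp (single a r) (single b s) = single (a, b) (r * s) := by
  simp [tp]

lemma tp_zero_left (g : γ →₀ R2) : tp (0 : β →₀ R2) g = 0 := by simp [tp]

lemma tp_zero_right (f : β →₀ R2) : tp f (0 : γ →₀ R2) = 0 := by simp [tp]

lemma tp_add_left (f f' : β →₀ R2) (g : γ →₀ R2) : tp (f + f') g = tp f g + tp f' g := by
  unfold tp
  rw [Finsupp.sum_add_index']
  · simp
  · intro a r s
    simp [add_mul, Finsupp.sum_add]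

lemma tp_add_right (f : β →₀ R2) (g g' : γ →₀ R2) : tp f (g + g') = tp f g + tp f g' := by
  unfold tp
  rw [← Finsupp.sum_add]
  refine Finsupp.sum_congr fun a _ => ?_
  rw [Finsupp.sum_add_index'] <;> simp [mul_add]

lemma tp_smul_left (r : R2) (f : β →₀ R2) (g : γ →₀ R2) : tp (r • f) g = r • tp f g := by
  unfold tp
  rw [Finsupp.sum_smul_index' (by simp), Finsupp.smul_sum]
  refine Finsupp.sum_congr fun a _ => ?_
  rw [Finsupp.smul_sum]
  exact Finsupp.sum_congr fun b _ => by rw [smul_single, smul_eq_mul, smul_eq_mul, mul_assoc]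

lemma tp_smul_right (r : R2) (f : β →₀ R2) (g : γ →₀ R2) : tp f (r • g) = r • tp f g := by
  unfold tp
  rw [Finsupp.smul_sum]
  refine Finsupp.sum_congr fun a _ => ?_
  rw [Finsupp.sum_smul_index' (by simp), Finsupp.smul_sum]
  exact Finsupp.sum_congr fun b _ => by
    rw [smul_single, smul_eq_mul, smul_eq_mul, mul_left_comm]

lemma tp_eq_of_basis {M : Type*} [AddCommGroup M] [Module R2 M]
    {L : ((β × γ) →₀ R2) →ₗ[R2] M} {B : (β →₀ R2) →ₗ[R2] (γ →₀ R2) →ₗ[R2] M}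
    (h : ∀ a b, L (single (a, b) 1) = B (single a 1) (single b 1)) (f : β →₀ R2) (g : γ →₀ R2) :
    L (tp f g) = B f g := by
  induction f using Finsupp.induction_linear with
  | zero => simp [tp_zero_left]
  | add f f' hf hf' => simp [tp_add_left, hf, hf']
  | single a r =>
    induction g using Finsupp.induction_linear with
    | zero => simp [tp_zero_right]
    | add g g' hg hg' => simp only [tp_add_right, map_add, hg, hg']
    | single b s =>
      rw [← mul_one r, ← mul_one s, ← smul_eq_mul r, ← smul_eq_mul s, ← smul_single,
        ← smul_single, tp_smul_left, tp_smul_right, tp_single_single, mul_one]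
      simp only [map_smul, h, LinearMap.smul_apply]
      exact smul_comm _ _ _

lemma skewExt_single (f : β → (γ →₀ R2)) (b : β) (r : R2) :
    skewExt f (single b r) = swUV r • f b := by
  simp [skewExt]

lemma skewExt_zero (f : β → (γ →₀ R2)) : skewExt f 0 = 0 := by
  simp [skewExt]

lemma skewExt_add (f : β → (γ →₀ R2)) (ξ η : β →₀ R2) :
    skewExt f (ξ + η) = skewExt f ξ + skewExt f η := by
  unfold skewExt
  rw [Finsupp.mapRange_add (by simp), map_add]

lemma skewExt_smul (f : β → (γ →₀ R2)) (r : R2) (ξ : β →₀ R2) :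
    skewExt f (r • ξ) = swUV r • skewExt f ξ := by
  induction ξ using Finsupp.induction_linear with
  | zero => simp [skewExt_zero]
  | add ξ η h h' => simp [skewExt_add, h, h']
  | single b s => rw [smul_single, skewExt_single, skewExt_single, smul_eq_mul, map_mul, mul_smul]

end Tensor

section Generators

variable {n : ℤ}

lemma dC_yC (l : ℤ) : dC n (yC n l) = 0 := by
  unfold yC
  split_ifs <;> simp [dC]

lemma dC_xC {k : ℤ} (h : k % 2 = 0 ∧ -(2*n - 2) ≤ k ∧ k ≤ 2*n - 2) :
    dC n (xC n k) =
      VV ^ (((k + 2*n)/2).toNat) • yC n (k - 1) + UU ^ (((2*n - k)/2).toNat) • yC n (k + 1) := by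
  rw [xC, dif_pos h, dC, linearCombination_single, one_smul]

lemma dC_dC (c : Cc n) : dC n (dC n c) = 0 := by
  have : dC n ∘ₗ dC n = 0 := by
    refine Finsupp.lhom_ext' fun b => LinearMap.ext_ring ?_
    simp only [LinearMap.comp_apply, lsingle_apply, LinearMap.zero_apply]
    rw [dC, linearCombination_single, one_smul, ← dC]
    rcases b with ⟨k, h⟩ | ⟨l, h⟩ <;> simp [dC_yC]
  exact LinearMap.congr_fun this c

lemma dT_tp (f g : Cc n) : dT n (tp f g) = tp (dC n f) g + tp f (dC n g) := by
  have key := tp_eq_of_basis (L := dT n)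
    (B := LinearMap.mk₂ R2 (fun f g : Cc n => tp (dC n f) g + tp f (dC n g))
      (fun f f' g => by simp only [map_add, tp_add_left]; abel)
      (fun r f g => by simp only [map_smul, tp_smul_left, smul_add])
      (fun f g g' => by simp only [map_add, tp_add_right]; abel)
      (fun r f g => by simp only [map_smul, tp_smul_right, smul_add]))
    (fun a b => by simp [dT]) f g
  simpa using key

lemma single_eq_tp (a b : CB n) : (single (a, b) 1 : Tc n) = tp (single a 1) (single b 1) := by
  simp [tp_single_single]

lemma dT_dT (c : Tc n) : dT n (dT n c) = 0 := by
  have : dT n ∘ₗ dT n = 0 := by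
    refine Finsupp.lhom_ext' fun ⟨a, b⟩ => LinearMap.ext_ring ?_
    simp only [LinearMap.comp_apply, lsingle_apply, single_eq_tp, dT_tp, map_add, dC_dC,
      tp_zero_left, tp_zero_right, zero_add, add_zero, LinearMap.zero_apply]
    exact add_self_of_R2_module _
  exact LinearMap.congr_fun this c

lemma ττ_single (a b : CB n) : ττ n (tp (single a 1) (single b 1)) = tp (τCb n a) (τCb n b) := by
  rw [tp_single_single, ττ, skewExt_single]
  simp

lemma ττ_yC_yC {i j : ℤ} (hi : i % 2 = 1 ∧ -(2*n - 1) ≤ i ∧ i ≤ 2*n - 1)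
    (hj : j % 2 = 1 ∧ -(2*n - 1) ≤ j ∧ j ≤ 2*n - 1) :
    ττ n (tp (yC n i) (yC n j)) = tp (yC n (-i)) (yC n (-j)) := by
  rw [yC, dif_pos hi, yC, dif_pos hj, ττ_single]; rfl

lemma ττ_xC_yC {i j : ℤ} (hi : i % 2 = 0 ∧ -(2*n - 2) ≤ i ∧ i ≤ 2*n - 2)
    (hj : j % 2 = 1 ∧ -(2*n - 1) ≤ j ∧ j ≤ 2*n - 1) :
    ττ n (tp (xC n i) (yC n j)) = tp (xC n (-i)) (yC n (-j)) := by
  rw [xC, dif_pos hi, yC, dif_pos hj, ττ_single]; rfl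

lemma ττ_yC_xC {i j : ℤ} (hi : i % 2 = 1 ∧ -(2*n - 1) ≤ i ∧ i ≤ 2*n - 1)
    (hj : j % 2 = 0 ∧ -(2*n - 2) ≤ j ∧ j ≤ 2*n - 2) :
    ττ n (tp (yC n i) (xC n j)) = tp (yC n (-i)) (xC n (-j)) := by
  rw [yC, dif_pos hi, xC, dif_pos hj, ττ_single]; rfl

lemma ττ_xC_xC {i j : ℤ} (hi : i % 2 = 0 ∧ -(2*n - 2) ≤ i ∧ i ≤ 2*n - 2)
    (hj : j % 2 = 0 ∧ -(2*n - 2) ≤ j ∧ j ≤ 2*n - 2) :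
    ττ n (tp (xC n i) (xC n j)) = tp (xC n (-i)) (xC n (-j)) := by
  rw [xC, dif_pos hi, xC, dif_pos hj, ττ_single]; rfl

end Generators

/-! ### Reducing cycles along a staircase -/

lemma cycle_reduction {M N : Type*} [AddCommGroup M] [Module R2 M] [AddCommGroup N] [Module R2 N]
    [Module.IsTorsionFree R2 N] (d : M →ₗ[R2] M) (hd : ∀ c, d (d c) = 0) (m : ℕ)
    (X : ℕ → N → M) (pX pY : ℕ → M →ₗ[R2] N) (u : ℕ → R2)
    (hu : ∀ j < m, ∃ (v : R2) (k : ℕ), v * u j = (UU * VV) ^ k)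
    (hY : ∀ j < m, ∀ q, pY j (d (X j q)) = u j • q)
    (hX : ∀ i j, j < i → i < m → ∀ q, pY i (d (X j q)) = 0 ∧ pX i (d (X j q)) = 0)
    (hXY : ∀ j < m, ∀ c, (∀ i, j < i → i < m → pX i c = 0) → pY j c = 0 →
      pY j (d c) = u j • pX j c)
    (c : M) (hc : d c = 0) :
    ∃ (k : ℕ) (w : M), ∀ j < m,
      pY j ((UU * VV) ^ k • c + d w) = 0 ∧ pX j ((UU * VV) ^ k • c + d w) = 0 := by
  suffices H : ∀ t ≤ m, ∃ (k : ℕ) (w : M), ∀ j < m, m ≤ j + t →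
      pY j ((UU * VV) ^ k • c + d w) = 0 ∧ pX j ((UU * VV) ^ k • c + d w) = 0 by
    obtain ⟨k, w, h⟩ := H m le_rfl
    exact ⟨k, w, fun j hj => h j hj (by omega)⟩
  intro t
  induction t with
  | zero => exact fun _ => ⟨0, 0, fun j hj hj' => by omega⟩
  | succ t ih =>
    intro ht
    obtain ⟨k, w, h⟩ := ih (by omega)
    obtain ⟨j, hj⟩ : ∃ j, j + (t + 1) = m := ⟨m - (t + 1), by omega⟩
    obtain ⟨v, e, hv⟩ := hu j (by omega)
    have hvu : v * u j ≠ 0 := by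
      rw [hv]
      exact pow_ne_zero _ (mul_ne_zero UU_ne_zero VV_ne_zero)
    set c₁ := (UU * VV) ^ k • c + d w with hc₁
    have hdc₁ : d c₁ = 0 := by simp [hc₁, hc, hd]
    set c₂ := u j • c₁ - d (X j (pY j c₁)) with hc₂
    have hdc₂ : d c₂ = 0 := by simp [hc₂, hdc₁, hd]
    have hhigh : ∀ i, j < i → i < m → pY i c₂ = 0 ∧ pX i c₂ = 0 := by
      intro i hi hi'
      have h1 := h i hi' (by omega)
      have h2 := hX i j hi hi' (pY j c₁)
      simp [hc₂, h1.1, h1.2, h2.1, h2.2]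
    have hYj : pY j c₂ = 0 := by
      simp [hc₂, hY j (by omega)]
    have hXj : pX j c₂ = 0 := by
      have h1 := hXY j (by omega) c₂ (fun i hi hi' => (hhigh i hi hi').2) hYj
      rw [hdc₂, map_zero] at h1
      exact (smul_eq_zero.mp h1.symm).resolve_left (right_ne_zero_of_mul hvu)
    have key : (UU * VV) ^ (e + k) • c + d ((UU * VV) ^ e • w - v • X j (pY j c₁)) = v • c₂ := by
      rw [hc₂, smul_sub, smul_smul, hv, hc₁]
      simp only [map_sub, map_smul, smul_add, smul_smul, pow_add]
      abel
    refine ⟨e + k, (UU * VV) ^ e • w - v • X j (pY j c₁), fun i hi hi' => ?_⟩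
    rw [key]
    rcases eq_or_ne i j with rfl | hne
    · simp [hYj, hXj]
    · obtain ⟨h1, h2⟩ := hhigh i (by omega) hi
      simp [h1, h2]

lemma exists_mul_UU_pow (e : ℕ) : ∃ (v : R2) (k : ℕ), v * UU ^ e = (UU * VV) ^ k :=
  ⟨VV ^ e, e, by ring⟩

/-! ### Coordinates on `C_n` and on `C_n ⊗ C_n` -/

/-- The coefficient of `x_k`. -/
noncomputable def cx (n k : ℤ) : Cc n →ₗ[R2] R2 :=
  if h : k % 2 = 0 ∧ -(2*n - 2) ≤ k ∧ k ≤ 2*n - 2 then lapply (.inl ⟨k, h⟩) else 0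

/-- The coefficient of `y_l`. -/
noncomputable def cy (n l : ℤ) : Cc n →ₗ[R2] R2 :=
  if h : l % 2 = 1 ∧ -(2*n - 1) ≤ l ∧ l ≤ 2*n - 1 then lapply (.inr ⟨l, h⟩) else 0

section Coordinates

variable {n : ℤ}

lemma cx_xC {k k' : ℤ} (h : k' % 2 = 0 ∧ -(2*n - 2) ≤ k' ∧ k' ≤ 2*n - 2) :
    cx n k (xC n k') = if k' = k then 1 else 0 := by
  rw [xC, dif_pos h, cx]
  split_ifs with h1 h2 h2
  · simp [h2]
  · simp [h2]
  · exact absurd (h2 ▸ h) h1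
  · simp

lemma cy_yC {l l' : ℤ} (h : l' % 2 = 1 ∧ -(2*n - 1) ≤ l' ∧ l' ≤ 2*n - 1) :
    cy n l (yC n l') = if l' = l then 1 else 0 := by
  rw [yC, dif_pos h, cy]
  split_ifs with h1 h2 h2
  · simp [h2]
  · simp [h2]
  · exact absurd (h2 ▸ h) h1
  · simp

lemma cx_yC (k l : ℤ) : cx n k (yC n l) = 0 := by
  unfold cx yC
  split_ifs <;> simp

lemma cx_dC (k : ℤ) (c : Cc n) : cx n k (dC n c) = 0 := by
  have : cx n k ∘ₗ dC n = 0 := by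
    refine Finsupp.lhom_ext' fun b => LinearMap.ext_ring ?_
    simp only [LinearMap.comp_apply, lsingle_apply, LinearMap.zero_apply]
    rw [dC, linearCombination_single, one_smul]
    rcases b with ⟨k, h⟩ | ⟨l, h⟩ <;> simp [cx_yC]
  exact LinearMap.congr_fun this c

lemma cy_dC {k : ℤ} (h : k % 2 = 0 ∧ -(2*n - 2) ≤ k ∧ k ≤ 2*n - 2) :
    cy n (k + 1) ∘ₗ dC n =
      UU ^ (((2*n - k)/2).toNat) • cx n k + VV ^ (((k + 2 + 2*n)/2).toNat) • cx n (k + 2) := by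
  refine Finsupp.lhom_ext' fun b => LinearMap.ext_ring ?_
  simp only [LinearMap.comp_apply, lsingle_apply, LinearMap.add_apply, LinearMap.smul_apply]
  rcases b with ⟨k', h'⟩ | ⟨l, h'⟩
  · have hx : (single (.inl ⟨k', h'⟩) 1 : Cc n) = xC n k' := by rw [xC, dif_pos h']
    rw [hx, dC_xC h', map_add, map_smul, map_smul, cx_xC h', cx_xC h',
      cy_yC (by omega), cy_yC (by omega)]
    by_cases h1 : k' = k
    · subst h1
      rw [if_neg (show ¬ (k' - 1 = k' + 1) by omega)]
      simp
    · by_cases h2 : k' = k + 2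
      · subst h2
        simp [show k + 2 - 1 = k + 1 by ring]
      · have h3 : ¬ (k' - 1 = k + 1) := by omega
        have h4 : ¬ (k' + 1 = k + 1) := by omega
        simp [h1, h2, h3]
  · have hy : (single (.inr ⟨l, h'⟩) 1 : Cc n) = yC n l := by rw [yC, dif_pos h']
    rw [hy, dC_yC, cx_yC, cx_yC]
    simp

/-- Contraction of the first tensor factor against a functional. -/
noncomputable def slice (f : Cc n →ₗ[R2] R2) : Tc n →ₗ[R2] Cc n :=
  linearCombination R2 fun p => f (single p.1 1) • single p.2 1

lemma slice_tp (f : Cc n →ₗ[R2] R2) (a g : Cc n) : slice f (tp a g) = f a • g := by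
  have key := tp_eq_of_basis (L := slice f)
    (B := LinearMap.mk₂ R2 (fun a g : Cc n => f a • g)
      (fun a a' g => by rw [map_add, add_smul])
      (fun r a g => by rw [map_smul, smul_eq_mul, mul_smul])
      (fun a g g' => by rw [smul_add])
      (fun r a g => by rw [smul_comm]))
    (fun a b => by simp only [slice, linearCombination_single, one_smul, LinearMap.mk₂_apply]) a g
  simpa using key

lemma slice_dT (f : Cc n →ₗ[R2] R2) (c : Tc n) :
    slice f (dT n c) = slice (f ∘ₗ dC n) c + dC n (slice f c) := by
  have : slice f ∘ₗ dT n = slice (f ∘ₗ dC n) + dC n ∘ₗ slice f := by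
    refine Finsupp.lhom_ext' fun ⟨a, b⟩ => LinearMap.ext_ring ?_
    simp only [LinearMap.comp_apply, lsingle_apply, LinearMap.add_apply, single_eq_tp, dT_tp,
      map_add, slice_tp, map_smul]
  exact LinearMap.congr_fun this c

lemma slice_add (f g : Cc n →ₗ[R2] R2) (c : Tc n) : slice (f + g) c = slice f c + slice g c := by
  have : slice (f + g) = slice f + slice g := by
    refine Finsupp.lhom_ext' fun ⟨a, b⟩ => LinearMap.ext_ring ?_
    simp only [LinearMap.comp_apply, lsingle_apply, LinearMap.add_apply, single_eq_tp, slice_tp,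
      add_smul]
  rw [this, LinearMap.add_apply]

lemma slice_smul (r : R2) (f : Cc n →ₗ[R2] R2) (c : Tc n) : slice (r • f) c = r • slice f c := by
  have : slice (r • f) = r • slice f := by
    refine Finsupp.lhom_ext' fun ⟨a, b⟩ => LinearMap.ext_ring ?_
    simp only [LinearMap.comp_apply, lsingle_apply, LinearMap.smul_apply, single_eq_tp, slice_tp,
      smul_eq_mul, mul_smul]
  rw [this, LinearMap.smul_apply]

lemma slice_zero (c : Tc n) : slice (0 : Cc n →ₗ[R2] R2) c = 0 := by
  simpa using slice_smul 0 (0 : Cc n →ₗ[R2] R2) c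

lemma slice_lapply (a b : CB n) (c : Tc n) : slice (lapply a) c b = c (a, b) := by
  have : lapply b ∘ₗ slice (lapply a) = lapply (a, b) := by
    refine Finsupp.lhom_ext' fun ⟨a', b'⟩ => LinearMap.ext_ring ?_
    simp only [LinearMap.comp_apply, lsingle_apply, single_eq_tp, slice_tp, lapply_apply,
      Finsupp.smul_apply, smul_eq_mul]
    simp only [tp_single_single, mul_one]
    classical
    simp only [single_apply, Prod.mk.injEq]
    split_ifs <;> simp_all
  exact LinearMap.congr_fun this c

lemma slice_cy_dT {k : ℤ} (h : k % 2 = 0 ∧ -(2*n - 2) ≤ k ∧ k ≤ 2*n - 2) (c : Tc n) :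
    slice (cy n (k + 1)) (dT n c) =
      UU ^ (((2*n - k)/2).toNat) • slice (cx n k) c +
        VV ^ (((k + 2 + 2*n)/2).toNat) • slice (cx n (k + 2)) c +
        dC n (slice (cy n (k + 1)) c) := by
  rw [slice_dT, cy_dC h, slice_add, slice_smul, slice_smul]

/-- The index of the `j`-th `x`-generator of `C_n`. -/
def xIndex (n : ℤ) (j : ℕ) : ℤ := -(2*n) + 2 + 2*j

lemma xIndex_mem {j : ℕ} (hj : j < (2*n - 1).toNat) :
    xIndex n j % 2 = 0 ∧ -(2*n - 2) ≤ xIndex n j ∧ xIndex n j ≤ 2*n - 2 := by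
  unfold xIndex
  omega

lemma eq_base_of_coordinates_eq_zero {c : Cc n} (hn : 1 ≤ n)
    (h : ∀ j < (2*n - 1).toNat, cy n (xIndex n j + 1) c = 0 ∧ cx n (xIndex n j) c = 0) :
    c = cy n (-(2*n - 1)) c • yC n (-(2*n - 1)) := by
  have hb : -(2*n - 1) % 2 = 1 ∧ -(2*n - 1) ≤ -(2*n - 1) ∧ -(2*n - 1) ≤ 2*n - 1 := by omega
  ext1 b
  rw [yC, dif_pos hb, cy, dif_pos hb]
  rcases b with ⟨k, hk⟩ | ⟨l, hl⟩
  · have := (h ((k + 2*n - 2)/2).toNat (by omega)).2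
    rw [show xIndex n ((k + 2*n - 2)/2).toNat = k by unfold xIndex; omega, cx, dif_pos hk] at this
    simpa using this
  · by_cases hl' : l = -(2*n - 1)
    · subst hl'
      simp
    · have := (h ((l + 2*n - 3)/2).toNat (by omega)).1
      rw [show xIndex n ((l + 2*n - 3)/2).toNat + 1 = l by unfold xIndex; omega, cy,
        dif_pos hl] at this
      rw [lapply_apply] at this
      rw [this, Finsupp.smul_apply, single_eq_of_ne, smul_zero]
      simpa using hl'

lemma eq_tp_base_of_slices_eq_zero {c : Tc n} (hn : 1 ≤ n)
    (h : ∀ j < (2*n - 1).toNat,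
      slice (cy n (xIndex n j + 1)) c = 0 ∧ slice (cx n (xIndex n j)) c = 0) :
    c = tp (yC n (-(2*n - 1))) (slice (cy n (-(2*n - 1))) c) := by
  have hb : -(2*n - 1) % 2 = 1 ∧ -(2*n - 1) ≤ -(2*n - 1) ∧ -(2*n - 1) ≤ 2*n - 1 := by omega
  ext1 ⟨a, b⟩
  rw [← slice_lapply, ← slice_lapply, slice_tp]
  rcases a with ⟨k, hk⟩ | ⟨l, hl⟩
  · have := (h ((k + 2*n - 2)/2).toNat (by omega)).2
    rw [show xIndex n ((k + 2*n - 2)/2).toNat = k by unfold xIndex; omega, cx, dif_pos hk] at this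
    rw [this, yC, dif_pos hb]
    simp
  · by_cases hl' : l = -(2*n - 1)
    · subst hl'
      rw [cy, dif_pos hl, yC, dif_pos hb]
      simp
    · have := (h ((l + 2*n - 3)/2).toNat (by omega)).1
      rw [show xIndex n ((l + 2*n - 3)/2).toNat + 1 = l by unfold xIndex; omega, cy,
        dif_pos hl] at this
      rw [this, yC, dif_pos hb, lapply_apply, single_eq_of_ne, zero_smul]
      simpa using hl'

lemma exists_dC_reduction (hn : 1 ≤ n) (c : Cc n) (hc : dC n c = 0) :
    ∃ (k : ℕ) (w : Cc n) (s : R2), (UU * VV) ^ k • c + dC n w = s • yC n (-(2*n - 1)) := by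
  obtain ⟨k, w, h⟩ := cycle_reduction (dC n) dC_dC (2*n - 1).toNat
    (fun j (q : R2) => q • xC n (xIndex n j))
    (fun j => cx n (xIndex n j)) (fun j => cy n (xIndex n j + 1))
    (fun j => UU ^ (((2*n - xIndex n j)/2).toNat)) (fun j _ => exists_mul_UU_pow _)
    (fun j hj q => by
      have h1 := LinearMap.congr_fun (cy_dC (xIndex_mem hj)) (xC n (xIndex n j))
      rw [LinearMap.comp_apply] at h1
      rw [map_smul, map_smul, h1]
      simp [cx_xC (xIndex_mem hj), mul_comm])
    (fun i j hij hi q => by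
      have hj := xIndex_mem (n := n) (j := j) (by omega)
      have h1 := LinearMap.congr_fun (cy_dC (xIndex_mem hi)) (xC n (xIndex n j))
      rw [LinearMap.comp_apply] at h1
      refine ⟨?_, cx_dC _ _⟩
      rw [map_smul, map_smul, h1]
      have h2 : xIndex n j ≠ xIndex n i := by unfold xIndex; omega
      have h3 : xIndex n j ≠ xIndex n i + 2 := by unfold xIndex; omega
      simp [cx_xC hj, h2, h3])
    (fun j hj c hc _ => by
      have h1 := LinearMap.congr_fun (cy_dC (xIndex_mem hj)) c
      rw [LinearMap.comp_apply] at h1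
      rw [h1]
      have h2 : cx n (xIndex n j + 2) c = 0 := by
        by_cases hj' : j + 1 < (2*n - 1).toNat
        · rw [← hc (j + 1) (by omega) hj']
          congr 2
          unfold xIndex
          push_cast
          ring
        · rw [cx, dif_neg (by unfold xIndex; omega), LinearMap.zero_apply]
      simp [h2])
    c hc
  exact ⟨k, w, _, eq_base_of_coordinates_eq_zero hn h⟩

lemma exists_dT_reduction_fst (hn : 1 ≤ n) (c : Tc n) (hc : dT n c = 0) :
    ∃ (k : ℕ) (w : Tc n) (q : Cc n),
      (UU * VV) ^ k • c + dT n w = tp (yC n (-(2*n - 1))) q := by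
  obtain ⟨k, w, h⟩ := cycle_reduction (dT n) dT_dT (2*n - 1).toNat
    (fun j (q : Cc n) => tp (xC n (xIndex n j)) q)
    (fun j => slice (cx n (xIndex n j))) (fun j => slice (cy n (xIndex n j + 1)))
    (fun j => UU ^ (((2*n - xIndex n j)/2).toNat)) (fun j _ => exists_mul_UU_pow _)
    (fun j hj q => by
      have hz : cy n (xIndex n j + 1) (xC n (xIndex n j)) = 0 := by
        unfold cy xC
        split_ifs <;> simp
      rw [slice_cy_dT (xIndex_mem hj)]
      simp [slice_tp, cx_xC (xIndex_mem hj), hz])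
    (fun i j hij hi q => by
      have hj := xIndex_mem (n := n) (j := j) (by omega)
      have hz : cy n (xIndex n i + 1) (xC n (xIndex n j)) = 0 := by
        unfold cy xC
        split_ifs <;> simp
      have h2 : xIndex n j ≠ xIndex n i := by unfold xIndex; omega
      have h3 : xIndex n j ≠ xIndex n i + 2 := by unfold xIndex; omega
      refine ⟨?_, ?_⟩
      · rw [slice_cy_dT (xIndex_mem hi)]
        simp [slice_tp, cx_xC hj, hz, h2, h3]
      · rw [dT_tp, map_add, slice_tp, slice_tp, cx_dC, cx_xC hj, if_neg h2]
        simp)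
    (fun j hj c hc hY => by
      have h2 : slice (cx n (xIndex n j + 2)) c = 0 := by
        by_cases hj' : j + 1 < (2*n - 1).toNat
        · rw [← hc (j + 1) (by omega) hj']
          congr 3
          unfold xIndex
          push_cast
          ring
        · rw [cx, dif_neg (by unfold xIndex; omega), slice_zero]
      rw [slice_cy_dT (xIndex_mem hj), h2, hY]
      simp)
    c hc
  exact ⟨k, w, _, eq_tp_base_of_slices_eq_zero hn h⟩

lemma exists_dT_reduction (hn : 1 ≤ n) (c : Tc n) (hc : dT n c = 0) :
    ∃ (k : ℕ) (w : Tc n) (s : R2),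
      (UU * VV) ^ k • c + dT n w = s • tp (yC n (-(2*n - 1))) (yC n (-(2*n - 1))) := by
  have hb : -(2*n - 1) % 2 = 1 ∧ -(2*n - 1) ≤ -(2*n - 1) ∧ -(2*n - 1) ≤ 2*n - 1 := by omega
  obtain ⟨k, w, q, h⟩ := exists_dT_reduction_fst hn c hc
  have hq : dC n q = 0 := by
    have h1 : dT n ((UU * VV) ^ k • c + dT n w) = 0 := by simp [hc, dT_dT]
    rw [h, dT_tp, dC_yC, tp_zero_left, zero_add] at h1
    have h2 := congrArg (slice (cy n (-(2*n - 1)))) h1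
    rwa [slice_tp, cy_yC hb, if_pos rfl, one_smul, map_zero] at h2
  obtain ⟨k', w', s, h'⟩ := exists_dC_reduction hn q hq
  refine ⟨k' + k, (UU * VV) ^ k' • w + tp (yC n (-(2*n - 1))) w', s, ?_⟩
  rw [← tp_smul_right, ← h', tp_add_right, tp_smul_right, ← h, map_add, map_smul, dT_tp, dC_yC,
    tp_zero_left, zero_add, smul_add, smul_smul, pow_add, add_assoc]

/-! ### The augmentation of `C_n ⊗ C_n` -/

/-- The exponent of `U` in the augmentation of `y_l`. -/
def augExp (n l : ℤ) : ℕ := ∑ i ∈ Finset.range ((2*n + 1 - l)/2).toNat, i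

lemma augExp_sub_one {k : ℤ} (h : k % 2 = 0 ∧ -(2*n - 2) ≤ k ∧ k ≤ 2*n - 2) :
    augExp n (k - 1) = augExp n (k + 1) + ((2*n - k)/2).toNat := by
  unfold augExp
  rw [show ((2*n + 1 - (k - 1))/2).toNat = ((2*n + 1 - (k + 1))/2).toNat + 1 by omega,
    Finset.sum_range_succ]
  congr 2
  omega

/-- The chain map `C_n → R` which is the localized homology isomorphism. -/
noncomputable def aug (n : ℤ) : Cc n →ₗ[R2] R2 :=
  linearCombination R2 fun b => match b with
  | .inl _ => 0
  | .inr ⟨l, _⟩ => UU ^ augExp n l * VV ^ augExp n (-l)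

lemma aug_yC {l : ℤ} (h : l % 2 = 1 ∧ -(2*n - 1) ≤ l ∧ l ≤ 2*n - 1) :
    aug n (yC n l) = UU ^ augExp n l * VV ^ augExp n (-l) := by
  rw [yC, dif_pos h, aug, linearCombination_single, one_smul]

lemma aug_dC (c : Cc n) : aug n (dC n c) = 0 := by
  have : aug n ∘ₗ dC n = 0 := by
    refine Finsupp.lhom_ext' fun b => LinearMap.ext_ring ?_
    simp only [LinearMap.comp_apply, lsingle_apply, LinearMap.zero_apply]
    rw [dC, linearCombination_single, one_smul]
    rcases b with ⟨k, h⟩ | ⟨l, h⟩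
    · simp only [map_add, map_smul]
      rw [aug_yC (by omega), aug_yC (by omega), augExp_sub_one h,
        show -(k + 1) = -k - 1 by ring, augExp_sub_one (n := n) (k := -k) (by omega),
        show -(k - 1) = -k + 1 by ring, show 2*n - -k = k + 2*n by ring, smul_eq_mul, smul_eq_mul]
      convert add_self_of_R2_module (M := R2) _ using 2
      ring
    · simp
  exact LinearMap.congr_fun this c

/-- The tensor square of `aug`. -/
noncomputable def augT (n : ℤ) : Tc n →ₗ[R2] R2 := aug n ∘ₗ slice (aug n)

lemma augT_dT (c : Tc n) : augT n (dT n c) = 0 := by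
  have h : aug n ∘ₗ dC n = 0 := LinearMap.ext aug_dC
  rw [augT, LinearMap.comp_apply, slice_dT, h, slice_zero, zero_add, aug_dC]

lemma augT_base_ne_zero (hn : 1 ≤ n) :
    augT n (tp (yC n (-(2*n - 1))) (yC n (-(2*n - 1)))) ≠ 0 := by
  have hb : -(2*n - 1) % 2 = 1 ∧ -(2*n - 1) ≤ -(2*n - 1) ∧ -(2*n - 1) ≤ 2*n - 1 := by omega
  rw [augT, LinearMap.comp_apply, slice_tp, map_smul, aug_yC hb, smul_eq_mul]
  have := mul_ne_zero (pow_ne_zero (augExp n (-(2*n - 1))) UU_ne_zero)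
    (pow_ne_zero (augExp n (-(-(2*n - 1)))) VV_ne_zero)
  exact mul_ne_zero this this

end Coordinates

/-! ### Coordinates and cycles of `E_n` -/

/-- The coefficient of `w_k`. -/
noncomputable def ew (n k : ℤ) : Ec n →ₗ[R2] R2 :=
  if h : k % 2 = 1 ∧ -(4*n - 3) ≤ k ∧ k ≤ 4*n - 3 then lapply (.inl (.inl ⟨k, h⟩)) else 0

/-- The coefficient of `z_l`. -/
noncomputable def ez (n l : ℤ) : Ec n →ₗ[R2] R2 :=
  if h : l % 2 = 0 ∧ -(4*n - 2) ≤ l ∧ l ≤ 4*n - 2 then lapply (.inl (.inr ⟨l, h⟩)) else 0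

section EComplex

variable {n : ℤ}

lemma dE_wE {k : ℤ} (h : k % 2 = 1 ∧ -(4*n - 3) ≤ k ∧ k ≤ 4*n - 3) :
    dE n (wE n k) = VV ^ (((k + 4*n + 2)/4).toNat) • zE n (k - 1) +
      UU ^ (((4*n + 2 - k)/4).toNat) • zE n (k + 1) := by
  rw [wE, dif_pos h, dE, linearCombination_single, one_smul]

lemma dE_zE (l : ℤ) : dE n (zE n l) = 0 := by
  unfold zE
  split_ifs <;> simp [dE]

lemma dE_r0 : dE n (sE n SB.r0) = VV ^ n.toNat • sE n SB.rm + UU ^ n.toNat • sE n SB.rp := by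
  rw [sE, dE, linearCombination_single, one_smul]

lemma dE_rm : dE n (sE n SB.rm) = UU ^ n.toNat • sE n SB.t := by
  rw [sE, dE, linearCombination_single, one_smul]

lemma dE_rp : dE n (sE n SB.rp) = VV ^ n.toNat • sE n SB.t := by
  rw [sE, dE, linearCombination_single, one_smul]

lemma dE_t : dE n (sE n SB.t) = 0 := by
  rw [sE, dE, linearCombination_single, one_smul]

lemma Ec_hom_ext {M : Type*} [AddCommGroup M] [Module R2 M] {f g : Ec n →ₗ[R2] M}
    (hw : ∀ k, k % 2 = 1 ∧ -(4*n - 3) ≤ k ∧ k ≤ 4*n - 3 → f (wE n k) = g (wE n k))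
    (hz : ∀ l, l % 2 = 0 ∧ -(4*n - 2) ≤ l ∧ l ≤ 4*n - 2 → f (zE n l) = g (zE n l))
    (hs : ∀ s, f (sE n s) = g (sE n s)) : f = g := by
  refine Finsupp.lhom_ext' fun b => LinearMap.ext_ring ?_
  simp only [LinearMap.comp_apply, lsingle_apply]
  rcases b with (⟨k, h⟩ | ⟨l, h⟩) | s
  · have := hw k h
    rwa [wE, dif_pos h] at this
  · have := hz l h
    rwa [zE, dif_pos h] at this
  · exact hs s

lemma dE_dE (e : Ec n) : dE n (dE n e) = 0 := by
  have : dE n ∘ₗ dE n = 0 := by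
    refine Ec_hom_ext (fun k h => ?_) (fun l _ => ?_) (fun s => ?_)
    · simp [dE_wE h, dE_zE]
    · simp [dE_zE]
    · cases s <;> simp [dE_r0, dE_rm, dE_rp, dE_t]
      rw [smul_comm]
      exact add_self_of_R2_module _
  exact LinearMap.congr_fun this e

lemma ew_wE {k k' : ℤ} (h : k' % 2 = 1 ∧ -(4*n - 3) ≤ k' ∧ k' ≤ 4*n - 3) :
    ew n k (wE n k') = if k' = k then 1 else 0 := by
  rw [wE, dif_pos h, ew]
  split_ifs with h1 h2 h2
  · simp [h2]
  · simp [h2]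
  · exact absurd (h2 ▸ h) h1
  · simp

lemma ez_zE {l l' : ℤ} (h : l' % 2 = 0 ∧ -(4*n - 2) ≤ l' ∧ l' ≤ 4*n - 2) :
    ez n l (zE n l') = if l' = l then 1 else 0 := by
  rw [zE, dif_pos h, ez]
  split_ifs with h1 h2 h2
  · simp [h2]
  · simp [h2]
  · exact absurd (h2 ▸ h) h1
  · simp

lemma ew_zE (k l : ℤ) : ew n k (zE n l) = 0 := by
  unfold ew zE
  split_ifs <;> simp

lemma ew_sE (k : ℤ) (s : SB) : ew n k (sE n s) = 0 := by
  unfold ew sE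
  split_ifs <;> simp

lemma ez_sE (l : ℤ) (s : SB) : ez n l (sE n s) = 0 := by
  unfold ez sE
  split_ifs <;> simp

lemma ew_dE (k : ℤ) (e : Ec n) : ew n k (dE n e) = 0 := by
  have : ew n k ∘ₗ dE n = 0 := by
    refine Ec_hom_ext (fun k h => ?_) (fun l _ => ?_) (fun s => ?_)
    · simp [dE_wE h, ew_zE]
    · simp [dE_zE]
    · cases s <;> simp [dE_r0, dE_rm, dE_rp, dE_t, ew_sE]
  exact LinearMap.congr_fun this e

lemma ez_dE {k : ℤ} (h : k % 2 = 1 ∧ -(4*n - 3) ≤ k ∧ k ≤ 4*n - 3) (e : Ec n) :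
    ez n (k + 1) (dE n e) =
      UU ^ (((4*n + 2 - k)/4).toNat) * ew n k e +
        VV ^ (((k + 2 + 4*n + 2)/4).toNat) * ew n (k + 2) e := by
  have : ez n (k + 1) ∘ₗ dE n = UU ^ (((4*n + 2 - k)/4).toNat) • ew n k +
      VV ^ (((k + 2 + 4*n + 2)/4).toNat) • ew n (k + 2) := by
    refine Ec_hom_ext (fun k' h' => ?_) (fun l _ => ?_) (fun s => ?_)
    · simp only [LinearMap.comp_apply, LinearMap.add_apply, LinearMap.smul_apply]
      rw [dE_wE h', map_add, map_smul, map_smul, ew_wE h', ew_wE h',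
        ez_zE (by omega), ez_zE (by omega)]
      by_cases h1 : k' = k
      · subst h1
        rw [if_neg (show ¬ (k' - 1 = k' + 1) by omega)]
        simp
      · by_cases h2 : k' = k + 2
        · subst h2
          simp [show k + 2 - 1 = k + 1 by ring]
        · have h3 : ¬ (k' - 1 = k + 1) := by omega
          simp [h1, h2, h3]
    · simp [dE_zE, ew_zE]
    · cases s <;> simp [dE_r0, dE_rm, dE_rp, dE_t, ew_sE, ez_sE]
  exact LinearMap.congr_fun this e

/-- The index of the `j`-th `w`-generator of `D_n`. -/
def wIndex (n : ℤ) (j : ℕ) : ℤ := -(4*n) + 3 + 2*j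

lemma wIndex_mem {j : ℕ} (hj : j < (4*n - 2).toNat) :
    wIndex n j % 2 = 1 ∧ -(4*n - 3) ≤ wIndex n j ∧ wIndex n j ≤ 4*n - 3 := by
  unfold wIndex
  omega

lemma eq_base_add_square_of_coordinates_eq_zero {e : Ec n} (hn : 1 ≤ n)
    (h : ∀ j < (4*n - 2).toNat, ez n (wIndex n j + 1) e = 0 ∧ ew n (wIndex n j) e = 0) :
    e = ez n (-(4*n - 2)) e • zE n (-(4*n - 2)) + (e (.inr SB.r0) • sE n SB.r0 +
      e (.inr SB.rm) • sE n SB.rm + e (.inr SB.rp) • sE n SB.rp + e (.inr SB.t) • sE n SB.t) := by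
  have hb : -(4*n - 2) % 2 = 0 ∧ -(4*n - 2) ≤ -(4*n - 2) ∧ -(4*n - 2) ≤ 4*n - 2 := by omega
  ext1 b
  rw [zE, dif_pos hb, ez, dif_pos hb]
  rcases b with (⟨k, hk⟩ | ⟨l, hl⟩) | s
  · have := (h ((k + 4*n - 3)/2).toNat (by omega)).2
    rw [show wIndex n ((k + 4*n - 3)/2).toNat = k by unfold wIndex; omega, ew, dif_pos hk] at this
    simpa [sE] using this
  · by_cases hl' : l = -(4*n - 2)
    · subst hl'
      simp [sE]
    · have := (h ((l + 4*n - 4)/2).toNat (by omega)).1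
      rw [show wIndex n ((l + 4*n - 4)/2).toNat + 1 = l by unfold wIndex; omega, ez,
        dif_pos hl, lapply_apply] at this
      rw [this, Finsupp.add_apply, Finsupp.smul_apply, single_eq_of_ne, smul_zero]
      · simp [sE]
      · simpa using hl'
  · cases s <;> simp [sE]

lemma exists_square_reduction {s a b c f : R2}
    (h : dE n (s • zE n (-(4*n - 2)) +
      (a • sE n SB.r0 + b • sE n SB.rm + c • sE n SB.rp + f • sE n SB.t)) = 0) :
    ∃ w : Ec n, (UU * VV) ^ n.toNat • (s • zE n (-(4*n - 2)) +
      (a • sE n SB.r0 + b • sE n SB.rm + c • sE n SB.rp + f • sE n SB.t)) + dE n w =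
      ((UU * VV) ^ n.toNat * s) • zE n (-(4*n - 2)) := by
  simp only [map_add, map_smul, dE_zE, dE_r0, dE_rm, dE_rp, dE_t] at h
  have ha : a = 0 := by
    have h1 := DFunLike.congr_fun h (.inr SB.rm)
    have h2 : zE n (-(4*n - 2)) (.inr SB.rm) = 0 := by
      unfold zE
      split_ifs <;> simp
    simpa [sE, VV_ne_zero, h2] using h1
  have hbc : b * UU ^ n.toNat + c * VV ^ n.toNat = 0 := by
    have h1 := DFunLike.congr_fun h (.inr SB.t)
    simpa [sE] using h1
  have hbc' : UU ^ n.toNat * b = VV ^ n.toNat * c := by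
    have h2 := add_self_of_R2_module (c * VV ^ n.toNat)
    linear_combination hbc - h2
  refine ⟨(UU ^ n.toNat * b) • sE n SB.r0 + (VV ^ n.toNat * f) • sE n SB.rm, ?_⟩
  have e1 : (UU ^ n.toNat * b) • UU ^ n.toNat • sE n SB.rp =
      ((UU * VV) ^ n.toNat * c) • sE n SB.rp := by
    rw [hbc', smul_smul]
    congr 1
    ring
  simp only [map_add, map_smul, dE_r0, dE_rm, smul_add, e1, ha, zero_smul, zero_add,
    smul_smul]
  have e2 : UU ^ n.toNat * b * VV ^ n.toNat = (UU * VV) ^ n.toNat * b := by ring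
  have e3 : VV ^ n.toNat * f * UU ^ n.toNat = (UU * VV) ^ n.toNat * f := by ring
  rw [e2, e3]
  generalize ((UU * VV) ^ n.toNat * b) • sE n SB.rm = p
  generalize ((UU * VV) ^ n.toNat * c) • sE n SB.rp = q
  generalize ((UU * VV) ^ n.toNat * f) • sE n SB.t = r
  have hp := add_self_of_R2_module p
  have hq := add_self_of_R2_module q
  have hr := add_self_of_R2_module r
  generalize ((UU * VV) ^ n.toNat * s) • zE n (-(4*n - 2)) = z
  calc z + (p + q + r) + (p + q + r) = z + ((p + p) + (q + q) + (r + r)) := by abel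
    _ = z := by rw [hp, hq, hr]; simp

lemma exists_dE_reduction (hn : 1 ≤ n) (e : Ec n) (he : dE n e = 0) :
    ∃ (k : ℕ) (w : Ec n) (s : R2), (UU * VV) ^ k • e + dE n w = s • zE n (-(4*n - 2)) := by
  obtain ⟨k, w, h⟩ := cycle_reduction (dE n) dE_dE (4*n - 2).toNat
    (fun j (q : R2) => q • wE n (wIndex n j))
    (fun j => ew n (wIndex n j)) (fun j => ez n (wIndex n j + 1))
    (fun j => UU ^ (((4*n + 2 - wIndex n j)/4).toNat)) (fun j _ => exists_mul_UU_pow _)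
    (fun j hj q => by
      rw [map_smul, map_smul, ez_dE (wIndex_mem hj)]
      simp [ew_wE (wIndex_mem hj), mul_comm])
    (fun i j hij hi q => by
      have hj := wIndex_mem (n := n) (j := j) (by omega)
      refine ⟨?_, ew_dE _ _⟩
      rw [map_smul, map_smul, ez_dE (wIndex_mem hi)]
      have h2 : wIndex n j ≠ wIndex n i := by unfold wIndex; omega
      have h3 : wIndex n j ≠ wIndex n i + 2 := by unfold wIndex; omega
      simp [ew_wE hj, h2, h3])
    (fun j hj c hc _ => by
      rw [ez_dE (wIndex_mem hj)]
      have h2 : ew n (wIndex n j + 2) c = 0 := by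
        by_cases hj' : j + 1 < (4*n - 2).toNat
        · rw [← hc (j + 1) (by omega) hj']
          congr 2
          unfold wIndex
          push_cast
          ring
        · rw [ew, dif_neg (by unfold wIndex; omega), LinearMap.zero_apply]
      simp [h2])
    e he
  have hcyc : dE n ((UU * VV) ^ k • e + dE n w) = 0 := by simp [he, dE_dE]
  have hform := eq_base_add_square_of_coordinates_eq_zero hn h
  rw [hform] at hcyc
  obtain ⟨w', hw'⟩ := exists_square_reduction hcyc
  rw [← hform] at hw'
  refine ⟨n.toNat + k, (UU * VV) ^ n.toNat • w + w', _, Eq.trans ?_ hw'⟩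
  rw [map_add, map_smul, smul_add, smul_smul, pow_add, add_assoc]

end EComplex

/-! ### The isomorphism from `E_n` onto `Y_n` -/

/-- The image of `w_k` in `C_n ⊗ C_n`. -/
noncomputable def wImage (n k : ℤ) : Tc n :=
  if k ≤ -2 then
    if k % 4 = 3 then tp (yC n ((k - 1)/2)) (xC n ((k + 1)/2))
    else tp (xC n ((k - 1)/2)) (yC n ((k + 1)/2))
  else
    if k % 4 = 3 then tp (xC n ((k + 1)/2)) (yC n ((k - 1)/2))
    else tp (yC n ((k + 1)/2)) (xC n ((k - 1)/2))

/-- The image of `z_l` in `C_n ⊗ C_n`. -/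
noncomputable def zImage (n l : ℤ) : Tc n :=
  if l % 4 = 2 then tp (yC n (l/2)) (yC n (l/2))
  else if l < 0 then tp (yC n (l/2 - 1)) (yC n (l/2 + 1))
  else tp (yC n (l/2 + 1)) (yC n (l/2 - 1))

/-- The images of the generators of the square complex in `C_n ⊗ C_n`. -/
noncomputable def sImage (n : ℤ) : SB → Tc n
  | SB.r0 => tp (xC n 0) (xC n 0)
  | SB.rm => tp (yC n (-1)) (xC n 0) + tp (xC n 0) (yC n (-1))
  | SB.rp => tp (yC n 1) (xC n 0) + tp (xC n 0) (yC n 1)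
  | SB.t => tp (yC n 1) (yC n (-1)) + tp (yC n (-1)) (yC n 1)

/-- The images of the generators of `E_n` in `C_n ⊗ C_n`. -/
noncomputable def generatorImage (n : ℤ) : EB n → Tc n
  | .inl (.inl k) => wImage n k
  | .inl (.inr l) => zImage n l
  | .inr s => sImage n s

/-- The isomorphism from `E_n` onto `Y_n`, as a map to `C_n ⊗ C_n`. -/
noncomputable def toTensor (n : ℤ) : Ec n →ₗ[R2] Tc n := linearCombination R2 (generatorImage n)

/-- A left inverse of `toTensor`. -/
noncomputable def ofTensor (n : ℤ) : Tc n →ₗ[R2] Ec n :=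
  linearCombination R2 fun p => match p with
  | (.inl _, .inl _) => sE n SB.r0
  | (.inl i, .inr j) => if i.1 = 0 ∧ j.1 = 1 then wE n 1 + sE n SB.rp else wE n (i.1 + j.1)
  | (.inr i, .inl j) => if i.1 = -1 ∧ j.1 = 0 then wE n (-1) + sE n SB.rm else wE n (i.1 + j.1)
  | (.inr i, .inr j) => if i.1 = -1 ∧ j.1 = 1 then zE n 0 + sE n SB.t else zE n (i.1 + j.1)

section Isomorphism

variable {n : ℤ}

lemma wImage_yC_xC {k i j : ℤ} (hk : k % 4 = 3) (hk' : k ≤ -2) (hi : 2*i = k - 1)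
    (hj : 2*j = k + 1) : wImage n k = tp (yC n i) (xC n j) := by
  rw [wImage, if_pos hk', if_pos hk, ← hi, ← hj, Int.mul_ediv_cancel_left _ two_ne_zero,
    Int.mul_ediv_cancel_left _ two_ne_zero]

lemma wImage_xC_yC {k i j : ℤ} (hk : k % 4 = 1) (hk' : k ≤ -2) (hi : 2*i = k - 1)
    (hj : 2*j = k + 1) : wImage n k = tp (xC n i) (yC n j) := by
  rw [wImage, if_pos hk', if_neg (by omega), ← hi, ← hj, Int.mul_ediv_cancel_left _ two_ne_zero,
    Int.mul_ediv_cancel_left _ two_ne_zero]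

lemma wImage_xC_yC' {k i j : ℤ} (hk : k % 4 = 3) (hk' : -1 ≤ k) (hi : 2*i = k + 1)
    (hj : 2*j = k - 1) : wImage n k = tp (xC n i) (yC n j) := by
  rw [wImage, if_neg (by omega), if_pos hk, ← hi, ← hj, Int.mul_ediv_cancel_left _ two_ne_zero,
    Int.mul_ediv_cancel_left _ two_ne_zero]

lemma wImage_yC_xC' {k i j : ℤ} (hk : k % 4 = 1) (hk' : -1 ≤ k) (hi : 2*i = k + 1)
    (hj : 2*j = k - 1) : wImage n k = tp (yC n i) (xC n j) := by
  rw [wImage, if_neg (by omega), if_neg (by omega), ← hi, ← hj,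
    Int.mul_ediv_cancel_left _ two_ne_zero, Int.mul_ediv_cancel_left _ two_ne_zero]

lemma zImage_diag {l i : ℤ} (hl : l % 4 = 2) (hi : 2*i = l) :
    zImage n l = tp (yC n i) (yC n i) := by
  rw [zImage, if_pos hl, ← hi, Int.mul_ediv_cancel_left _ two_ne_zero]

lemma zImage_of_neg {l i j : ℤ} (hl : l % 4 = 0) (hl' : l < 0) (hi : 2*i = l - 2)
    (hj : 2*j = l + 2) : zImage n l = tp (yC n i) (yC n j) := by
  rw [zImage, if_neg (by omega), if_pos hl', show l/2 - 1 = i by omega, show l/2 + 1 = j by omega]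

lemma zImage_of_nonneg {l i j : ℤ} (hl : l % 4 = 0) (hl' : 0 ≤ l) (hi : 2*i = l + 2)
    (hj : 2*j = l - 2) : zImage n l = tp (yC n i) (yC n j) := by
  rw [zImage, if_neg (by omega), if_neg (by omega), show l/2 - 1 = j by omega,
    show l/2 + 1 = i by omega]

lemma toTensor_wE {k : ℤ} (h : k % 2 = 1 ∧ -(4*n - 3) ≤ k ∧ k ≤ 4*n - 3) :
    toTensor n (wE n k) = wImage n k := by
  rw [wE, dif_pos h, toTensor, linearCombination_single, one_smul]
  rfl

lemma toTensor_zE {l : ℤ} (h : l % 2 = 0 ∧ -(4*n - 2) ≤ l ∧ l ≤ 4*n - 2) :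
    toTensor n (zE n l) = zImage n l := by
  rw [zE, dif_pos h, toTensor, linearCombination_single, one_smul]
  rfl

lemma toTensor_sE (s : SB) : toTensor n (sE n s) = sImage n s := by
  rw [sE, toTensor, linearCombination_single, one_smul]
  rfl

/-- The four shapes of the elements `wImage n k`. -/
lemma wImage_cases {k : ℤ} (h : k % 2 = 1 ∧ -(4*n - 3) ≤ k ∧ k ≤ 4*n - 3) {P : Prop}
    (h₁ : ∀ i, i % 2 = 1 → -(2*n - 1) ≤ i → i ≤ -3 → k = 2*i + 1 →
      wImage n k = tp (yC n i) (xC n (i + 1)) → P)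
    (h₂ : ∀ i, i % 2 = 0 → -(2*n - 2) ≤ i → i ≤ -2 → k = 2*i + 1 →
      wImage n k = tp (xC n i) (yC n (i + 1)) → P)
    (h₃ : ∀ i, i % 2 = 0 → 0 ≤ i → i ≤ 2*n - 2 → k = 2*i - 1 →
      wImage n k = tp (xC n i) (yC n (i - 1)) → P)
    (h₄ : ∀ i, i % 2 = 1 → 1 ≤ i → i ≤ 2*n - 1 → k = 2*i - 1 →
      wImage n k = tp (yC n i) (xC n (i - 1)) → P) : P := by
  by_cases hk : k ≤ -2
  · by_cases hk4 : k % 4 = 3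
    · exact h₁ ((k - 1)/2) (by omega) (by omega) (by omega) (by omega)
        (wImage_yC_xC hk4 hk (by omega) (by omega))
    · exact h₂ ((k - 1)/2) (by omega) (by omega) (by omega) (by omega)
        (wImage_xC_yC (by omega) hk (by omega) (by omega))
  · by_cases hk4 : k % 4 = 3
    · exact h₃ ((k + 1)/2) (by omega) (by omega) (by omega) (by omega)
        (wImage_xC_yC' hk4 (by omega) (by omega) (by omega))
    · exact h₄ ((k + 1)/2) (by omega) (by omega) (by omega) (by omega)
        (wImage_yC_xC' (by omega) (by omega) (by omega) (by omega))

/-- The three shapes of the elements `zImage n l`. -/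
lemma zImage_cases {l : ℤ} (h : l % 2 = 0 ∧ -(4*n - 2) ≤ l ∧ l ≤ 4*n - 2) {P : Prop}
    (h₁ : ∀ i, i % 2 = 1 → -(2*n - 1) ≤ i → i ≤ 2*n - 1 → l = 2*i →
      zImage n l = tp (yC n i) (yC n i) → P)
    (h₂ : ∀ i, i % 2 = 1 → -(2*n - 1) ≤ i → i ≤ -3 → l = 2*i + 2 →
      zImage n l = tp (yC n i) (yC n (i + 2)) → P)
    (h₃ : ∀ i, i % 2 = 1 → -1 ≤ i → i ≤ 2*n - 3 → l = 2*i + 2 →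
      zImage n l = tp (yC n (i + 2)) (yC n i) → P) : P := by
  by_cases hl : l % 4 = 2
  · exact h₁ (l/2) (by omega) (by omega) (by omega) (by omega) (zImage_diag hl (by omega))
  · by_cases hl' : l < 0
    · exact h₂ (l/2 - 1) (by omega) (by omega) (by omega) (by omega)
        (zImage_of_neg (by omega) hl' (by omega) (by omega))
    · exact h₃ (l/2 - 1) (by omega) (by omega) (by omega) (by omega)
        (zImage_of_nonneg (by omega) (by omega) (by omega) (by omega))

lemma YGens_eq_range (hn : 1 ≤ n) : YGens n = Set.range (generatorImage n) := by
  apply Set.Subset.antisymm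
  · have W : ∀ k, k % 2 = 1 ∧ -(4*n - 3) ≤ k ∧ k ≤ 4*n - 3 →
        wImage n k ∈ Set.range (generatorImage n) := fun k hk => ⟨.inl (.inl ⟨k, hk⟩), rfl⟩
    have Z : ∀ l, l % 2 = 0 ∧ -(4*n - 2) ≤ l ∧ l ≤ 4*n - 2 →
        zImage n l ∈ Set.range (generatorImage n) := fun l hl => ⟨.inl (.inr ⟨l, hl⟩), rfl⟩
    rintro ξ (⟨i, h1, h2, h3, rfl⟩ | ⟨i, h1, h2, h3, rfl⟩ | ⟨i, h1, h2, h3, rfl⟩ |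
      ⟨i, h1, h2, h3, rfl⟩ | ⟨i, h1, h2, h3, rfl⟩ | ⟨i, h1, h2, h3, rfl⟩ | ⟨i, h1, h2, h3, rfl⟩ |
      rfl | rfl | rfl | rfl)
    · rw [← zImage_diag (l := 2*i) (by omega) rfl]
      exact Z _ (by omega)
    · rw [← zImage_of_neg (l := 2*i + 2) (by omega) (by omega) (by omega) (by omega)]
      exact Z _ (by omega)
    · rw [← zImage_of_nonneg (l := 2*i + 2) (by omega) (by omega) (by omega) (by omega)]
      exact Z _ (by omega)
    · rw [← wImage_yC_xC (k := 2*i + 1) (by omega) (by omega) (by omega) (by omega)]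
      exact W _ (by omega)
    · rw [← wImage_xC_yC (k := 2*i + 1) (by omega) (by omega) (by omega) (by omega)]
      exact W _ (by omega)
    · rw [← wImage_xC_yC' (k := 2*i - 1) (by omega) (by omega) (by omega) (by omega)]
      exact W _ (by omega)
    · rw [← wImage_yC_xC' (k := 2*i - 1) (by omega) (by omega) (by omega) (by omega)]
      exact W _ (by omega)
    · exact ⟨.inr SB.t, rfl⟩
    · exact ⟨.inr SB.rm, rfl⟩
    · exact ⟨.inr SB.rp, rfl⟩
    · exact ⟨.inr SB.r0, rfl⟩
  · rintro _ ⟨(⟨k, h⟩ | ⟨l, h⟩) | s, rfl⟩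
    · change wImage n k ∈ YGens n
      refine wImage_cases h ?_ ?_ ?_ ?_ <;> intro i h1 h2 h3 _ e
      · exact .inr (.inr (.inr (.inl ⟨i, h1, h2, h3, e⟩)))
      · exact .inr (.inr (.inr (.inr (.inl ⟨i, h1, h2, h3, e⟩))))
      · exact .inr (.inr (.inr (.inr (.inr (.inl ⟨i, h1, h2, h3, e⟩)))))
      · exact .inr (.inr (.inr (.inr (.inr (.inr (.inl ⟨i, h1, h2, h3, e⟩))))))
    · change zImage n l ∈ YGens n
      refine zImage_cases h ?_ ?_ ?_ <;> intro i h1 h2 h3 _ e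
      · exact .inl ⟨i, h1, h2, h3, e⟩
      · exact .inr (.inl ⟨i, h1, h2, h3, e⟩)
      · exact .inr (.inr (.inl ⟨i, h1, h2, h3, e⟩))
    · cases s
      · exact .inr (.inr (.inr (.inr (.inr (.inr (.inr (.inr (.inr (.inr rfl)))))))))
      · exact .inr (.inr (.inr (.inr (.inr (.inr (.inr (.inr (.inl rfl))))))))
      · exact .inr (.inr (.inr (.inr (.inr (.inr (.inr (.inr (.inr (.inl rfl)))))))))
      · exact .inr (.inr (.inr (.inr (.inr (.inr (.inr (.inl rfl)))))))

lemma range_toTensor (hn : 1 ≤ n) : LinearMap.range (toTensor n) = Ysub n := by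
  rw [toTensor, Finsupp.range_linearCombination, Ysub, YGens_eq_range hn]

lemma ofTensor_xC_xC {i j : ℤ} (hi : i % 2 = 0 ∧ -(2*n - 2) ≤ i ∧ i ≤ 2*n - 2)
    (hj : j % 2 = 0 ∧ -(2*n - 2) ≤ j ∧ j ≤ 2*n - 2) :
    ofTensor n (tp (xC n i) (xC n j)) = sE n SB.r0 := by
  rw [xC, dif_pos hi, xC, dif_pos hj, ← single_eq_tp, ofTensor, linearCombination_single, one_smul]

lemma ofTensor_xC_yC {i j : ℤ} (hi : i % 2 = 0 ∧ -(2*n - 2) ≤ i ∧ i ≤ 2*n - 2)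
    (hj : j % 2 = 1 ∧ -(2*n - 1) ≤ j ∧ j ≤ 2*n - 1) :
    ofTensor n (tp (xC n i) (yC n j)) =
      if i = 0 ∧ j = 1 then wE n 1 + sE n SB.rp else wE n (i + j) := by
  rw [xC, dif_pos hi, yC, dif_pos hj, ← single_eq_tp, ofTensor, linearCombination_single, one_smul]

lemma ofTensor_yC_xC {i j : ℤ} (hi : i % 2 = 1 ∧ -(2*n - 1) ≤ i ∧ i ≤ 2*n - 1)
    (hj : j % 2 = 0 ∧ -(2*n - 2) ≤ j ∧ j ≤ 2*n - 2) :
    ofTensor n (tp (yC n i) (xC n j)) =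
      if i = -1 ∧ j = 0 then wE n (-1) + sE n SB.rm else wE n (i + j) := by
  rw [yC, dif_pos hi, xC, dif_pos hj, ← single_eq_tp, ofTensor, linearCombination_single, one_smul]

lemma ofTensor_yC_yC {i j : ℤ} (hi : i % 2 = 1 ∧ -(2*n - 1) ≤ i ∧ i ≤ 2*n - 1)
    (hj : j % 2 = 1 ∧ -(2*n - 1) ≤ j ∧ j ≤ 2*n - 1) :
    ofTensor n (tp (yC n i) (yC n j)) =
      if i = -1 ∧ j = 1 then zE n 0 + sE n SB.t else zE n (i + j) := by
  rw [yC, dif_pos hi, yC, dif_pos hj, ← single_eq_tp, ofTensor, linearCombination_single, one_smul]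

lemma ofTensor_toTensor (hn : 1 ≤ n) (e : Ec n) : ofTensor n (toTensor n e) = e := by
  have : ofTensor n ∘ₗ toTensor n = LinearMap.id := by
    refine Ec_hom_ext (fun k h => ?_) (fun l h => ?_) (fun s => ?_)
    · rw [LinearMap.comp_apply, toTensor_wE h, LinearMap.id_apply]
      refine wImage_cases h ?_ ?_ ?_ ?_ <;> intro i h1 h2 h3 hk e <;> rw [e]
      · rw [ofTensor_yC_xC (by omega) (by omega), if_neg (by omega)]
        congr 1; omega
      · rw [ofTensor_xC_yC (by omega) (by omega), if_neg (by omega)]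
        congr 1; omega
      · rw [ofTensor_xC_yC (by omega) (by omega), if_neg (by omega)]
        congr 1; omega
      · rw [ofTensor_yC_xC (by omega) (by omega), if_neg (by omega)]
        congr 1; omega
    · rw [LinearMap.comp_apply, toTensor_zE h, LinearMap.id_apply]
      refine zImage_cases h ?_ ?_ ?_ <;> intro i h1 h2 h3 hk e <;>
        rw [e, ofTensor_yC_yC (by omega) (by omega), if_neg (by omega)] <;> congr 1 <;> omega
    · rw [LinearMap.comp_apply, toTensor_sE, LinearMap.id_apply]
      cases s <;> simp only [sImage, map_add]
      · rw [ofTensor_xC_xC (by omega) (by omega)]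
      · rw [ofTensor_yC_xC (by omega) (by omega), ofTensor_xC_yC (by omega) (by omega),
          if_pos (by omega), if_neg (by omega), add_right_comm, zero_add, add_self_of_R2_module,
          zero_add]
      · rw [ofTensor_yC_xC (by omega) (by omega), ofTensor_xC_yC (by omega) (by omega),
          if_neg (by omega), if_pos (by omega), ← add_assoc, add_zero, add_self_of_R2_module,
          zero_add]
      · rw [ofTensor_yC_yC (by omega) (by omega), ofTensor_yC_yC (by omega) (by omega),
          if_neg (by omega), if_pos (by omega), ← add_assoc, show (1 : ℤ) + -1 = 0 by norm_num,
          add_self_of_R2_module, zero_add]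
  exact LinearMap.congr_fun this e

lemma toTensor_injective (hn : 1 ≤ n) : Function.Injective (toTensor n) :=
  Function.LeftInverse.injective (ofTensor_toTensor hn)

lemma dT_wImage {k : ℤ} (h : k % 2 = 1 ∧ -(4*n - 3) ≤ k ∧ k ≤ 4*n - 3) :
    dT n (wImage n k) = VV ^ (((k + 4*n + 2)/4).toNat) • zImage n (k - 1) +
      UU ^ (((4*n + 2 - k)/4).toNat) • zImage n (k + 1) := by
  refine wImage_cases h ?_ ?_ ?_ ?_ <;> intro i h1 h2 h3 hk e <;> rw [e, dT_tp, dC_yC] <;>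
    subst hk
  · rw [dC_xC (by omega), tp_zero_left, zero_add, tp_add_right, tp_smul_right, tp_smul_right,
      zImage_diag (i := i) (by omega) (by omega),
      zImage_of_neg (i := i) (j := i + 1 + 1) (by omega) (by omega) (by omega) (by omega),
      add_sub_cancel_right]
    congr 4 <;> omega
  · rw [dC_xC (by omega), tp_zero_right, add_zero, tp_add_left, tp_smul_left, tp_smul_left,
      zImage_diag (l := 2*i + 1 + 1) (i := i + 1) (by omega) (by omega),
      zImage_of_neg (i := i - 1) (j := i + 1) (by omega) (by omega) (by omega) (by omega)]
    congr 4 <;> omega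
  · rw [dC_xC (by omega), tp_zero_right, add_zero, tp_add_left, tp_smul_left, tp_smul_left,
      zImage_diag (i := i - 1) (by omega) (by omega),
      zImage_of_nonneg (i := i + 1) (j := i - 1) (by omega) (by omega) (by omega) (by omega)]
    congr 4 <;> omega
  · rw [dC_xC (by omega), tp_zero_left, zero_add, tp_add_right, tp_smul_right, tp_smul_right,
      zImage_diag (l := 2*i - 1 + 1) (i := i) (by omega) (by omega),
      zImage_of_nonneg (i := i) (j := i - 1 - 1) (by omega) (by omega) (by omega) (by omega),
      sub_add_cancel]
    congr 4 <;> omega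

lemma toTensor_dE (hn : 1 ≤ n) (e : Ec n) : toTensor n (dE n e) = dT n (toTensor n e) := by
  have : toTensor n ∘ₗ dE n = dT n ∘ₗ toTensor n := by
    refine Ec_hom_ext (fun k h => ?_) (fun l h => ?_) (fun s => ?_) <;>
      simp only [LinearMap.comp_apply]
    · rw [toTensor_wE h, dT_wImage h, dE_wE h, map_add, map_smul, map_smul,
        toTensor_zE (by omega), toTensor_zE (by omega)]
    · rw [dE_zE, map_zero, toTensor_zE h]
      refine zImage_cases h ?_ ?_ ?_ <;> intro i _ _ _ _ e <;>
        simp only [e, dT_tp, dC_yC, tp_zero_left, tp_zero_right, add_zero]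
    · have hx : dC n (xC n 0) = VV ^ n.toNat • yC n (-1) + UU ^ n.toNat • yC n 1 := by
        rw [dC_xC (by omega)]
        congr 4 <;> omega
      rw [toTensor_sE]
      cases s
      · simp only [dE_r0, map_add, map_smul, toTensor_sE, sImage, dT_tp, hx, tp_add_left,
          tp_add_right, tp_smul_left, tp_smul_right, smul_add]
        abel
      · simp only [dE_rm, map_add, map_smul, toTensor_sE, sImage, dT_tp, hx, tp_add_left,
          tp_add_right, tp_smul_left, tp_smul_right, smul_add, dC_yC, tp_zero_left, tp_zero_right,
          zero_add, add_zero]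
        rw [add_add_add_comm, add_self_of_R2_module, zero_add, add_comm]
      · simp only [dE_rp, map_add, map_smul, toTensor_sE, sImage, dT_tp, hx, tp_add_left,
          tp_add_right, tp_smul_left, tp_smul_right, smul_add, dC_yC, tp_zero_left, tp_zero_right,
          zero_add, add_zero]
        rw [add_add_add_comm, add_self_of_R2_module (UU ^ n.toNat • _), add_zero]
      · simp only [dE_t, map_add, map_zero, sImage, dT_tp, dC_yC, tp_zero_left, tp_zero_right,
          add_zero]
  exact LinearMap.congr_fun this e

lemma τE_wE {k : ℤ} (h : k % 2 = 1 ∧ -(4*n - 3) ≤ k ∧ k ≤ 4*n - 3) :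
    τE n (wE n k) = if k = -1 then wE n 1 + sE n SB.rp
      else if k = 1 then wE n (-1) + sE n SB.rm else wE n (-k) := by
  rw [wE, dif_pos h, τE, skewExt_single, map_one, one_smul]

lemma τE_zE {l : ℤ} (h : l % 2 = 0 ∧ -(4*n - 2) ≤ l ∧ l ≤ 4*n - 2) :
    τE n (zE n l) = if l = 0 then zE n 0 + sE n SB.t else zE n (-l) := by
  rw [zE, dif_pos h, τE, skewExt_single, map_one, one_smul]

lemma τE_sE (s : SB) : τE n (sE n s) = match s with
    | SB.r0 => sE n SB.r0
    | SB.rm => sE n SB.rp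
    | SB.rp => sE n SB.rm
    | SB.t => sE n SB.t := by
  rw [sE, τE, skewExt_single, map_one, one_smul]
  cases s <;> rfl

lemma toTensor_τE_wE (hn : 1 ≤ n) {k : ℤ} (h : k % 2 = 1 ∧ -(4*n - 3) ≤ k ∧ k ≤ 4*n - 3) :
    toTensor n (τE n (wE n k)) = ττ n (wImage n k) := by
  rw [τE_wE h]
  by_cases hm : k = -1
  · subst hm
    rw [if_pos rfl, map_add, toTensor_wE (by omega), toTensor_sE, sImage,
      wImage_yC_xC' (i := 1) (j := 0) (by omega) (by omega) (by omega) (by omega),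
      wImage_xC_yC' (i := 0) (j := -1) (by omega) (by omega) (by omega) (by omega),
      ττ_xC_yC (by omega) (by omega), ← add_assoc, add_self_of_R2_module, zero_add]
    rfl
  by_cases hp : k = 1
  · subst hp
    rw [if_neg hm, if_pos rfl, map_add, toTensor_wE (by omega), toTensor_sE, sImage,
      wImage_yC_xC' (k := 1) (i := 1) (j := 0) (by omega) (by omega) (by omega) (by omega),
      wImage_xC_yC' (k := -1) (i := 0) (j := -1) (by omega) (by omega) (by omega) (by omega),
      ττ_yC_xC (by omega) (by omega), add_left_comm, add_self_of_R2_module, add_zero]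
    rfl
  rw [if_neg hm, if_neg hp, toTensor_wE (by omega)]
  refine wImage_cases h ?_ ?_ ?_ ?_ <;> intro i h1 h2 h3 hk e <;> rw [e]
  · rw [ττ_yC_xC (by omega) (by omega)]
    exact wImage_yC_xC' (by omega) (by omega) (by omega) (by omega)
  · rw [ττ_xC_yC (by omega) (by omega)]
    exact wImage_xC_yC' (by omega) (by omega) (by omega) (by omega)
  · rw [ττ_xC_yC (by omega) (by omega)]
    exact wImage_xC_yC (by omega) (by omega) (by omega) (by omega)
  · rw [ττ_yC_xC (by omega) (by omega)]
    exact wImage_yC_xC (by omega) (by omega) (by omega) (by omega)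

lemma toTensor_τE_zE (hn : 1 ≤ n) {l : ℤ} (h : l % 2 = 0 ∧ -(4*n - 2) ≤ l ∧ l ≤ 4*n - 2) :
    toTensor n (τE n (zE n l)) = ττ n (zImage n l) := by
  rw [τE_zE h]
  by_cases h0 : l = 0
  · subst h0
    rw [if_pos rfl, map_add, toTensor_zE (by omega), toTensor_sE, sImage,
      zImage_of_nonneg (i := 1) (j := -1) (by omega) (by omega) (by omega) (by omega),
      ττ_yC_yC (by omega) (by omega), ← add_assoc, add_self_of_R2_module, zero_add]
    rfl
  rw [if_neg h0, toTensor_zE (by omega)]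
  refine zImage_cases h ?_ ?_ ?_ <;> intro i h1 h2 h3 hk e <;>
    rw [e, ττ_yC_yC (by omega) (by omega)]
  · exact zImage_diag (by omega) (by omega)
  · exact zImage_of_nonneg (by omega) (by omega) (by omega) (by omega)
  · exact zImage_of_neg (by omega) (by omega) (by omega) (by omega)

lemma toTensor_τE_sE (hn : 1 ≤ n) (s : SB) : toTensor n (τE n (sE n s)) = ττ n (sImage n s) := by
  have hadd : ∀ ξ η : Tc n, ττ n (ξ + η) = ττ n ξ + ττ n η := skewExt_add _
  rw [τE_sE]
  cases s <;> simp only [toTensor_sE, sImage, hadd]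
  · rw [ττ_xC_xC (by omega) (by omega)]
    rfl
  · rw [ττ_xC_yC (by omega) (by omega), ττ_yC_xC (by omega) (by omega)]
    rfl
  · rw [ττ_xC_yC (by omega) (by omega), ττ_yC_xC (by omega) (by omega)]
    rfl
  · rw [ττ_yC_yC (by omega) (by omega), ττ_yC_yC (by omega) (by omega), add_comm]
    rfl

lemma toTensor_τE (hn : 1 ≤ n) (e : Ec n) : toTensor n (τE n e) = ττ n (toTensor n e) := by
  induction e using Finsupp.induction_linear with
  | zero => rw [τE, skewExt_zero, map_zero, ττ, skewExt_zero]
  | add e e' h h' =>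
    rw [τE, skewExt_add, map_add, ← τE, h, h', map_add]
    exact (skewExt_add _ _ _).symm
  | single b r =>
    have hb : toTensor n (τE n (single b 1)) = ττ n (toTensor n (single b 1)) := by
      rcases b with (⟨k, h⟩ | ⟨l, h⟩) | s
      · have := toTensor_τE_wE hn h
        rwa [← toTensor_wE h, wE, dif_pos h] at this
      · have := toTensor_τE_zE hn h
        rwa [← toTensor_zE h, zE, dif_pos h] at this
      · have := toTensor_τE_sE hn s
        rwa [← toTensor_sE] at this
    rw [← mul_one r, ← smul_eq_mul r, ← smul_single, τE, skewExt_smul, map_smul, ← τE, hb,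
      map_smul]
    exact (skewExt_smul _ _ _).symm

end Isomorphism

/-! ### Bigradings -/

section Grading

variable {n : ℤ} {gx gy gw gz : ℤ → ℤ × ℤ} {gS : SB → ℤ × ℤ}

lemma Homog.add {β : Type} {g : β → ℤ × ℤ} {deg : ℤ × ℤ} {ξ η : β →₀ R2}
    (hξ : Homog g deg ξ) (hη : Homog g deg η) : Homog g deg (ξ + η) := by
  intro b _ m hm
  rw [Finsupp.add_apply] at hm
  have key : ∀ ζ : β →₀ R2, Homog g deg ζ → m ∈ (ζ b).support →
      (g b).1 - 2 * (m 0 : ℤ) = deg.1 ∧ (g b).2 - 2 * (m 1 : ℤ) = deg.2 := by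
    intro ζ hζ hmζ
    refine hζ b (Finsupp.mem_support_iff.mpr fun h0 => ?_) m hmζ
    simp [h0] at hmζ
  classical
  rcases Finset.mem_union.mp (MvPolynomial.support_add hm) with h | h
  · exact key ξ hξ h
  · exact key η hη h

lemma homog_single {β : Type} {g : β → ℤ × ℤ} {deg : ℤ × ℤ} {b : β} (h : g b = deg) :
    Homog g deg (single b 1) := by
  intro b' hb' m hm
  have hb : b' = b := by
    by_contra hne
    rw [Finsupp.mem_support_iff, single_eq_of_ne hne] at hb'
    exact hb' rfl
  subst hb
  rw [single_eq_same] at hm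
  have hm0 : m = 0 := by
    rw [← MvPolynomial.C_1, MvPolynomial.C_apply] at hm
    simpa using MvPolynomial.support_monomial_subset hm
  simp [hm0, h]

lemma homog_yC_yC {i j : ℤ} (hi : i % 2 = 1 ∧ -(2*n - 1) ≤ i ∧ i ≤ 2*n - 1)
    (hj : j % 2 = 1 ∧ -(2*n - 1) ≤ j ∧ j ≤ 2*n - 1) {deg : ℤ × ℤ}
    (h₁ : (gy i).1 + (gy j).1 = deg.1) (h₂ : (gy i).2 + (gy j).2 = deg.2) :
    Homog (grT gx gy) deg (tp (yC n i) (yC n j)) := by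
  rw [yC, dif_pos hi, yC, dif_pos hj, ← single_eq_tp]
  exact homog_single (Prod.ext h₁ h₂)

lemma homog_xC_yC {i j : ℤ} (hi : i % 2 = 0 ∧ -(2*n - 2) ≤ i ∧ i ≤ 2*n - 2)
    (hj : j % 2 = 1 ∧ -(2*n - 1) ≤ j ∧ j ≤ 2*n - 1) {deg : ℤ × ℤ}
    (h₁ : (gx i).1 + (gy j).1 = deg.1) (h₂ : (gx i).2 + (gy j).2 = deg.2) :
    Homog (grT gx gy) deg (tp (xC n i) (yC n j)) := by
  rw [xC, dif_pos hi, yC, dif_pos hj, ← single_eq_tp]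
  exact homog_single (Prod.ext h₁ h₂)

lemma homog_yC_xC {i j : ℤ} (hi : i % 2 = 1 ∧ -(2*n - 1) ≤ i ∧ i ≤ 2*n - 1)
    (hj : j % 2 = 0 ∧ -(2*n - 2) ≤ j ∧ j ≤ 2*n - 2) {deg : ℤ × ℤ}
    (h₁ : (gy i).1 + (gx j).1 = deg.1) (h₂ : (gy i).2 + (gx j).2 = deg.2) :
    Homog (grT gx gy) deg (tp (yC n i) (xC n j)) := by
  rw [yC, dif_pos hi, xC, dif_pos hj, ← single_eq_tp]
  exact homog_single (Prod.ext h₁ h₂)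

lemma homog_xC_xC {i j : ℤ} (hi : i % 2 = 0 ∧ -(2*n - 2) ≤ i ∧ i ≤ 2*n - 2)
    (hj : j % 2 = 0 ∧ -(2*n - 2) ≤ j ∧ j ≤ 2*n - 2) {deg : ℤ × ℤ}
    (h₁ : (gx i).1 + (gx j).1 = deg.1) (h₂ : (gx i).2 + (gx j).2 = deg.2) :
    Homog (grT gx gy) deg (tp (xC n i) (xC n j)) := by
  rw [xC, dif_pos hi, xC, dif_pos hj, ← single_eq_tp]
  exact homog_single (Prod.ext h₁ h₂)

lemma IsCGrading.eqs (hC : IsCGrading n gx gy) {k a b : ℤ} (hk : k % 2 = 0)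
    (h1 : -(2*n - 2) ≤ k) (h2 : k ≤ 2*n - 2) (ha : a = k - 1) (hb : b = k + 1) :
    (gy a).1 = (gx k).1 - 1 ∧ (gy a).2 = (gx k).2 - 1 + (k + 2*n) ∧
    (gy b).1 = (gx k).1 - 1 + (2*n - k) ∧ (gy b).2 = (gx k).2 - 1 := by
  subst ha hb
  obtain ⟨h, h'⟩ := hC.2.2 k hk h1 h2
  simp [h, h']

lemma IsDGrading.eqs (hD : IsDGrading n gw gz) {k a b : ℤ} (hk : k % 2 = 1)
    (h1 : -(4*n - 3) ≤ k) (h2 : k ≤ 4*n - 3) (ha : a = k - 1) (hb : b = k + 1) :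
    (gz a).1 = (gw k).1 - 1 ∧ (gz a).2 = (gw k).2 - 1 + 2*((k + 4*n + 2)/4) ∧
    (gz b).1 = (gw k).1 - 1 + 2*((4*n + 2 - k)/4) ∧ (gz b).2 = (gw k).2 - 1 := by
  subst ha hb
  obtain ⟨h, h'⟩ := hD.2.2 k hk h1 h2
  simp [h, h']

lemma gz_diag_fst (hC : IsCGrading n gx gy) (hD : IsDGrading n gw gz) (j : ℕ) :
    ∀ i, i = 2*n - 1 - 2*j → -(2*n - 1) ≤ i → (gz (2*i)).1 = 2 * (gy i).1 := by
  induction j with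
  | zero =>
    rintro i rfl _
    have h1 := hD.2.1
    have h2 := hC.2.1
    simp only [Nat.cast_zero, mul_zero, sub_zero]
    rw [show 2*(2*n - 1) = 4*n - 2 by ring, h1, h2]
    rfl
  | succ j ih =>
    intro i hi hi'
    have h0 := ih (i + 2) (by push_cast at hi; omega) (by omega)
    push_cast at hi
    have hc := hC.eqs (k := i + 1) (a := i) (b := i + 2) (by omega) (by omega) (by omega)
      (by omega) (by omega)
    have hd := hD.eqs (k := 2*i + 1) (a := 2*i) (b := 2*i + 2) (by omega) (by omega) (by omega)
      (by omega) (by omega)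
    have hd' := hD.eqs (k := 2*i + 3) (a := 2*i + 2) (b := 2*(i + 2)) (by omega) (by omega)
      (by omega) (by omega) (by omega)
    omega

lemma gz_diag_snd (hC : IsCGrading n gx gy) (hD : IsDGrading n gw gz) (j : ℕ) :
    ∀ i, i = -(2*n - 1) + 2*j → i ≤ 2*n - 1 → (gz (2*i)).2 = 2 * (gy i).2 := by
  induction j with
  | zero =>
    rintro i rfl _
    have h1 := hD.1
    have h2 := hC.1
    simp only [Nat.cast_zero, mul_zero, add_zero]
    rw [show 2*(-(2*n - 1)) = -(4*n) + 2 by ring, show -(2*n - 1) = -(2*n) + 1 by ring, h1, h2]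
    rfl
  | succ j ih =>
    intro i hi hi'
    have h0 := ih (i - 2) (by push_cast at hi; omega) (by omega)
    push_cast at hi
    have hc := hC.eqs (k := i - 1) (a := i - 2) (b := i) (by omega) (by omega) (by omega)
      (by omega) (by omega)
    have hd := hD.eqs (k := 2*i - 1) (a := 2*i - 2) (b := 2*i) (by omega) (by omega) (by omega)
      (by omega) (by omega)
    have hd' := hD.eqs (k := 2*i - 3) (a := 2*(i - 2)) (b := 2*i - 2) (by omega) (by omega)
      (by omega) (by omega) (by omega)
    omega

lemma gz_diag (hC : IsCGrading n gx gy) (hD : IsDGrading n gw gz) {i : ℤ}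
    (hi : i % 2 = 1 ∧ -(2*n - 1) ≤ i ∧ i ≤ 2*n - 1) :
    (gz (2*i)).1 = 2 * (gy i).1 ∧ (gz (2*i)).2 = 2 * (gy i).2 :=
  ⟨gz_diag_fst hC hD ((2*n - 1 - i)/2).toNat i (by omega) (by omega),
    gz_diag_snd hC hD ((i + (2*n - 1))/2).toNat i (by omega) (by omega)⟩

lemma gz_offDiag (hC : IsCGrading n gx gy) (hD : IsDGrading n gw gz) {i : ℤ}
    (hi : i % 2 = 1 ∧ -(2*n - 1) ≤ i ∧ i ≤ 2*n - 3) :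
    (gz (2*i + 2)).1 = (gy i).1 + (gy (i + 2)).1 ∧
      (gz (2*i + 2)).2 = (gy i).2 + (gy (i + 2)).2 := by
  have h0 := gz_diag hC hD (i := i) (by omega)
  have hc := hC.eqs (k := i + 1) (a := i) (b := i + 2) (by omega) (by omega) (by omega)
    (by omega) (by omega)
  have hd := hD.eqs (k := 2*i + 1) (a := 2*i) (b := 2*i + 2) (by omega) (by omega) (by omega)
    (by omega) (by omega)
  omega

lemma homog_wImage (hC : IsCGrading n gx gy) (hD : IsDGrading n gw gz) {k : ℤ}
    (h : k % 2 = 1 ∧ -(4*n - 3) ≤ k ∧ k ≤ 4*n - 3) :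
    Homog (grT gx gy) (gw k) (wImage n k) := by
  refine wImage_cases h ?_ ?_ ?_ ?_ <;> intro i h1 h2 h3 hk e <;> rw [e]
  · have h0 := gz_diag hC hD (i := i) (by omega)
    have hc := hC.eqs (k := i + 1) (a := i) (b := i + 2) (by omega) (by omega) (by omega)
      (by omega) (by omega)
    have hd := hD.eqs (k := k) (a := 2*i) (b := 2*i + 2) (by omega) (by omega) (by omega)
      (by omega) (by omega)
    refine homog_yC_xC (by omega) (by omega) ?_ ?_ <;> omega
  · have h0 := gz_diag hC hD (i := i + 1) (by omega)
    have hc := hC.eqs (k := i) (a := i - 1) (b := i + 1) (by omega) (by omega) (by omega)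
      (by omega) (by omega)
    have hd := hD.eqs (k := k) (a := 2*i) (b := 2*(i + 1)) (by omega) (by omega) (by omega)
      (by omega) (by omega)
    refine homog_xC_yC (by omega) (by omega) ?_ ?_ <;> omega
  · have h0 := gz_diag hC hD (i := i - 1) (by omega)
    have hc := hC.eqs (k := i) (a := i - 1) (b := i + 1) (by omega) (by omega) (by omega)
      (by omega) (by omega)
    have hd := hD.eqs (k := k) (a := 2*(i - 1)) (b := 2*i) (by omega) (by omega) (by omega)
      (by omega) (by omega)
    refine homog_xC_yC (by omega) (by omega) ?_ ?_ <;> omega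
  · have h0 := gz_diag hC hD (i := i) (by omega)
    have hc := hC.eqs (k := i - 1) (a := i - 2) (b := i) (by omega) (by omega) (by omega)
      (by omega) (by omega)
    have hd := hD.eqs (k := k) (a := 2*i - 2) (b := 2*i) (by omega) (by omega) (by omega)
      (by omega) (by omega)
    refine homog_yC_xC (by omega) (by omega) ?_ ?_ <;> omega

lemma homog_zImage (hC : IsCGrading n gx gy) (hD : IsDGrading n gw gz) {l : ℤ}
    (h : l % 2 = 0 ∧ -(4*n - 2) ≤ l ∧ l ≤ 4*n - 2) :
    Homog (grT gx gy) (gz l) (zImage n l) := by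
  refine zImage_cases h ?_ ?_ ?_ <;> intro i h1 h2 h3 hl e <;> rw [e, hl]
  · have h0 := gz_diag hC hD (i := i) (by omega)
    refine homog_yC_yC (by omega) (by omega) ?_ ?_ <;> omega
  · have h0 := gz_offDiag hC hD (i := i) (by omega)
    refine homog_yC_yC (by omega) (by omega) ?_ ?_ <;> omega
  · have h0 := gz_offDiag hC hD (i := i) (by omega)
    refine homog_yC_yC (by omega) (by omega) ?_ ?_ <;> omega

lemma homog_sImage (hn : 1 ≤ n) (hC : IsCGrading n gx gy) (hD : IsDGrading n gw gz)
    (hS : IsSGrading n gz gS) (s : SB) : Homog (grT gx gy) (gS s) (sImage n s) := by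
  obtain ⟨ht, h1, h2, h3, h4, h5, h6, h7, h8⟩ := hS
  have h0 := gz_offDiag hC hD (i := -1) (by omega)
  norm_num at h0
  have hc := hC.eqs (k := 0) (a := -1) (b := 1) (by omega) (by omega) (by omega)
    (by omega) (by omega)
  rw [ht] at h1 h2 h3 h4
  cases s <;> simp only [sImage]
  · refine homog_xC_xC (by omega) (by omega) ?_ ?_ <;> omega
  · refine Homog.add (homog_yC_xC (by omega) (by omega) ?_ ?_)
      (homog_xC_yC (by omega) (by omega) ?_ ?_) <;> omega
  · refine Homog.add (homog_yC_xC (by omega) (by omega) ?_ ?_)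
      (homog_xC_yC (by omega) (by omega) ?_ ?_) <;> omega
  · rw [ht]
    refine Homog.add (homog_yC_yC (by omega) (by omega) ?_ ?_)
      (homog_yC_yC (by omega) (by omega) ?_ ?_) <;> omega

lemma homog_toTensor_single (hn : 1 ≤ n) (hC : IsCGrading n gx gy) (hD : IsDGrading n gw gz)
    (hS : IsSGrading n gz gS) (b : EB n) :
    Homog (grT gx gy) (grE gw gz gS b) (toTensor n (single b 1)) := by
  rw [toTensor, linearCombination_single, one_smul]
  rcases b with (⟨k, h⟩ | ⟨l, h⟩) | s
  · exact homog_wImage hC hD h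
  · exact homog_zImage hC hD h
  · exact homog_sImage hn hC hD hS s

end Grading

/-! ### Localized homology of the inclusion -/

section Homology

variable {n : ℤ}

lemma toTensor_zE_base (hn : 1 ≤ n) :
    toTensor n (zE n (-(4*n - 2))) = tp (yC n (-(2*n - 1))) (yC n (-(2*n - 1))) := by
  rw [toTensor_zE (by omega)]
  exact zImage_diag (by omega) (by omega)

lemma inclusion_homology_surjective (hn : 1 ≤ n) (c : Tc n) (hc : dT n c = 0) :
    ∃ (k : ℕ) (y w : Tc n), y ∈ Ysub n ∧ dT n y = 0 ∧ (UU * VV) ^ k • c = y + dT n w := by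
  obtain ⟨k, w, s, h⟩ := exists_dT_reduction hn c hc
  refine ⟨k, s • tp (yC n (-(2*n - 1))) (yC n (-(2*n - 1))), w, ?_, ?_, ?_⟩
  · rw [← toTensor_zE_base hn, ← range_toTensor hn]
    exact Submodule.smul_mem _ _ (LinearMap.mem_range_self _ _)
  · rw [map_smul, dT_tp, dC_yC, tp_zero_left, tp_zero_right, add_zero, smul_zero]
  · rw [← h, add_assoc, add_self_of_R2_module, add_zero]

lemma inclusion_homology_injective (hn : 1 ≤ n) (y : Tc n) (hy : y ∈ Ysub n) (hdy : dT n y = 0)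
    (hb : ∃ (k : ℕ) (w : Tc n), (UU * VV) ^ k • y = dT n w) :
    ∃ (k : ℕ) (w : Tc n), w ∈ Ysub n ∧ (UU * VV) ^ k • y = dT n w := by
  obtain ⟨k, w, hw⟩ := hb
  rw [← range_toTensor hn] at hy
  obtain ⟨e, rfl⟩ := hy
  have he : dE n e = 0 := by
    apply toTensor_injective hn
    rw [toTensor_dE hn, hdy, map_zero]
  obtain ⟨k', e', s, h⟩ := exists_dE_reduction hn e he
  have h' := congrArg (toTensor n) h
  rw [map_add, map_smul, map_smul, toTensor_dE hn, toTensor_zE_base hn] at h'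
  have hzero : augT n (toTensor n e) = 0 := by
    have h1 := congrArg (augT n) hw
    rw [map_smul, augT_dT, smul_eq_zero] at h1
    exact h1.resolve_left (pow_ne_zero _ (mul_ne_zero UU_ne_zero VV_ne_zero))
  have hs : s = 0 := by
    have h1 := congrArg (augT n) h'
    rw [map_add, map_smul, map_smul, augT_dT, hzero, smul_zero, add_zero, eq_comm,
      smul_eq_zero] at h1
    exact h1.resolve_right (augT_base_ne_zero hn)
  rw [hs, zero_smul] at h'
  refine ⟨k', toTensor n e', ?_, ?_⟩
  · rw [← range_toTensor hn]
    exact LinearMap.mem_range_self _ _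
  · rw [eq_neg_of_add_eq_zero_left h', neg_eq_self_of_R2_module]

end Homology

/-- (i) `Y_n` is a subcomplex of `C_n ⊗_R C_n` preserved by `τ ⊗ τ`;
(ii) there is a bigraded isomorphism of chain complexes from `E_n` onto `Y_n` carrying
`τ_E` to the restriction of `τ ⊗ τ`; (iii) the inclusion `Y_n ↪ C_n ⊗_R C_n` induces an
isomorphism on homology after tensoring over `R` with `F₂[U^{±1}, V^{±1}]`
(equivalently, after inverting `UV`; this is expressed below by saying that the induced
map of homologies becomes surjective and injective up to multiplication by powers of
`UV`). -/
theorem Y_subcomplex_isomorphic_to_E (n : ℤ) (hn : 1 ≤ n) :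
    -- (i) `Y_n` is a subcomplex, preserved by `τ ⊗ τ`:
    ((∀ ξ ∈ Ysub n, dT n ξ ∈ Ysub n) ∧ (∀ ξ ∈ Ysub n, ττ n ξ ∈ Ysub n)) ∧
    -- (ii) a bigraded isomorphism of chain complexes `E_n ≅ Y_n` intertwining `τ_E`
    -- with (the restriction of) `τ ⊗ τ`:
    (∃ φ : Ec n →ₗ[R2] Tc n,
      Function.Injective φ ∧ LinearMap.range φ = Ysub n ∧
      (∀ ξ, φ (dE n ξ) = dT n (φ ξ)) ∧
      (∀ ξ, φ (τE n ξ) = ττ n (φ ξ)) ∧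
      (∀ gx gy gw gz gS, IsCGrading n gx gy → IsDGrading n gw gz → IsSGrading n gz gS →
        ∀ b : EB n, Homog (grT gx gy) (grE gw gz gS b) (φ (single b 1)))) ∧
    -- (iii) the inclusion induces an isomorphism on homology after inverting `UV`:
    ((∀ c : Tc n, dT n c = 0 →
        ∃ (k : ℕ) (y w : Tc n), y ∈ Ysub n ∧ dT n y = 0 ∧ (UU * VV)^k • c = y + dT n w) ∧
     (∀ y ∈ Ysub n, dT n y = 0 →
        (∃ (k : ℕ) (w : Tc n), (UU * VV)^k • y = dT n w) →
        ∃ (k : ℕ) (w : Tc n), w ∈ Ysub n ∧ (UU * VV)^k • y = dT n w)) := by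
  have hrange := range_toTensor hn
  refine ⟨⟨?_, ?_⟩, ⟨toTensor n, toTensor_injective hn, hrange, toTensor_dE hn, toTensor_τE hn,
    fun _ _ _ _ _ hC hD hS => homog_toTensor_single hn hC hD hS⟩,
    inclusion_homology_surjective hn, inclusion_homology_injective hn⟩
  · rw [← hrange]
    rintro _ ⟨e, rfl⟩
    exact ⟨dE n e, toTensor_dE hn e⟩
  · rw [← hrange]
    rintro _ ⟨e, rfl⟩
    exact ⟨τE n e, toTensor_τE hn e⟩
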